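/- arXiv:1812.10597 — 6 statements merged into one kernel-verified Lean document; each statement's English description precedes it below -/
import Mathlib

section
/- Let R be a commutative Noetherian local ring and let M and N be nonzero finitely generated R-modules such that M has finite projective dimension. If Tor_i^R(M,N) = 0 for all i ≥ 1, then depth_R(M) + depth_R(N) = depth(R) + depth_R(M ⊗_R N). -/
open CategoryTheory

/-- The depth of a module over a local ring: the supremum of the lengths of
`M`-regular sequences contained in the maximal ideal of `R`. -/
noncomputable def moduleDepth (R : Type) [CommRing R] [IsLocalRing R]
    (M : Type) [AddCommGroup M] [Module R M] : ℕ :=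
  sSup {n : ℕ | ∃ rs : List R, rs.length = n ∧
    (∀ r ∈ rs, r ∈ IsLocalRing.maximalIdeal R) ∧ RingTheory.Sequence.IsRegular M rs}

/-- The `i`-th Tor module `Tor_i^R(X, Y)` of two `R`-modules. -/
noncomputable abbrev torMod (R : Type) [CommRing R] (i : ℕ)
    (X : Type) [AddCommGroup X] [Module R X]
    (Y : Type) [AddCommGroup Y] [Module R Y] : Type :=
  ((Tor (ModuleCat R) i).obj (ModuleCat.of R X)).obj (ModuleCat.of R Y)

/-- `M` has finite projective dimension over `R`: there is a projective resolution
`⋯ → P_1 → P_0 → M → 0` of `M` that vanishes in all large degrees. -/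
def HasFiniteProjDim (R : Type) [CommRing R]
    (M : Type) [AddCommGroup M] [Module R M] : Prop :=
  ∃ (n : ℕ) (P : ℕ → ModuleCat R) (d : ∀ i, P (i + 1) ⟶ P i) (ε : P 0 ⟶ ModuleCat.of R M),
    Function.Surjective ε ∧ Function.Exact (d 0) ε ∧
    (∀ i, Function.Exact (d (i + 1)) (d i)) ∧
    (∀ i, Projective (P i)) ∧ (∀ i, n < i → Subsingleton (P i))

open CategoryTheory Abelian TensorProduct

section ExtResidueField

variable {R : Type} [CommRing R] [IsLocalRing R]

/-- The residue field of a local ring, as an object of the category of modules. -/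
noncomputable abbrev residueFieldModule (R : Type) [CommRing R] [IsLocalRing R] : ModuleCat R :=
  ModuleCat.of R (R ⧸ IsLocalRing.maximalIdeal R)

/-- The least degree in which `Ext(k, M)` does not vanish is `t`. -/
def IsExtDepth (R : Type) [CommRing R] [IsLocalRing R]
    (M : Type) [AddCommGroup M] [Module R M] (t : ℕ) : Prop :=
  (∀ i < t, Subsingleton (Ext (residueFieldModule R) (ModuleCat.of R M) i)) ∧
    ¬ Subsingleton (Ext (residueFieldModule R) (ModuleCat.of R M) t)

variable {A B C : Type} [AddCommGroup A] [Module R A] [AddCommGroup B] [Module R B]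
  [AddCommGroup C] [Module R C]

/-- The map induced on `Ext^i(k, -)` by a linear map. -/
noncomputable def extMap (i : ℕ) (f : A →ₗ[R] B) :
    Ext (residueFieldModule R) (ModuleCat.of R A) i →+
      Ext (residueFieldModule R) (ModuleCat.of R B) i :=
  (Ext.mk₀ (ModuleCat.ofHom f)).postcomp (residueFieldModule R) (add_zero i)

lemma extMap_apply (i : ℕ) (f : A →ₗ[R] B)
    (x : Ext (residueFieldModule R) (ModuleCat.of R A) i) :
    extMap i f x = x.comp (Ext.mk₀ (ModuleCat.ofHom f)) (add_zero i) := rfl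

lemma extMap_id (i : ℕ) (x : Ext (residueFieldModule R) (ModuleCat.of R A) i) :
    extMap i (LinearMap.id : A →ₗ[R] A) x = x := by
  simp [extMap_apply]

lemma extMap_comp (i : ℕ) (g : B →ₗ[R] C) (f : A →ₗ[R] B)
    (x : Ext (residueFieldModule R) (ModuleCat.of R A) i) :
    extMap i (g ∘ₗ f) x = extMap i g (extMap i f x) := by
  simp [extMap_apply, ModuleCat.ofHom_comp, ← Ext.mk₀_comp_mk₀]

lemma extMap_add (i : ℕ) (f g : A →ₗ[R] B) : extMap i (f + g) = extMap i f + extMap i g := by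
  ext x
  simp [extMap_apply, ModuleCat.ofHom_add, Ext.mk₀_add]

lemma extMap_zero (i : ℕ) : extMap i (0 : A →ₗ[R] B) = 0 := by
  ext x
  simp [extMap_apply]

lemma extMap_sum (i : ℕ) {ι : Type*} (s : Finset ι) (f : ι → A →ₗ[R] B) :
    extMap i (∑ j ∈ s, f j) = ∑ j ∈ s, extMap i (f j) := by
  classical
  induction s using Finset.induction_on with
  | empty => simp [extMap_zero]
  | insert a s ha ih => rw [Finset.sum_insert ha, Finset.sum_insert ha, extMap_add, ih]

lemma extMap_smul_eq_zero (i : ℕ) (f : A →ₗ[R] B) {r : R}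
    (hr : r ∈ IsLocalRing.maximalIdeal R) : extMap i (r • f) = 0 := by
  have h : r ∈ Module.annihilator R (residueFieldModule R) := by
    change r ∈ Module.annihilator R (R ⧸ IsLocalRing.maximalIdeal R)
    rwa [Ideal.annihilator_quotient]
  ext x
  have h0 := Ext.postcomp_smul_id_eq_zero_of_mem_annihilator
    (M := ModuleCat.of R A) h i
  have h1 : extMap i (r • (LinearMap.id : A →ₗ[R] A)) x = 0 :=
    DFunLike.congr_fun (congrArg AddCommGrpCat.Hom.hom h0) x
  have h2 : r • f = f ∘ₗ (r • LinearMap.id) := by ext; simp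
  rw [h2, extMap_comp, h1, map_zero, AddMonoidHom.zero_apply]

lemma extMap_eq_zero_of_mem_smul_top (i : ℕ) (f : A →ₗ[R] B)
    (hf : f ∈ IsLocalRing.maximalIdeal R • (⊤ : Submodule R (A →ₗ[R] B))) :
    extMap i f = 0 := by
  induction hf using Submodule.smul_induction_on' with
  | smul r hr g _ => exact extMap_smul_eq_zero i g hr
  | add g _ h _ hg hh => rw [extMap_add, hg, hh, add_zero]

lemma subsingleton_ext_of_leftInverse (i : ℕ) (f : A →ₗ[R] B) (g : B →ₗ[R] A)
    (h : g ∘ₗ f = LinearMap.id)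
    (hB : Subsingleton (Ext (residueFieldModule R) (ModuleCat.of R B) i)) :
    Subsingleton (Ext (residueFieldModule R) (ModuleCat.of R A) i) := by
  refine subsingleton_of_forall_eq 0 fun x ↦ ?_
  rw [← extMap_id i x, ← h, extMap_comp, Subsingleton.elim (extMap i f x) 0, map_zero]

lemma subsingleton_ext_congr (i : ℕ) (e : A ≃ₗ[R] B) :
    Subsingleton (Ext (residueFieldModule R) (ModuleCat.of R A) i) ↔
      Subsingleton (Ext (residueFieldModule R) (ModuleCat.of R B) i) :=
  ⟨subsingleton_ext_of_leftInverse i e.symm.toLinearMap e.toLinearMap (by ext; simp),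
    subsingleton_ext_of_leftInverse i e.toLinearMap e.symm.toLinearMap (by ext; simp)⟩

lemma IsExtDepth.congr (e : A ≃ₗ[R] B) {t : ℕ} (h : IsExtDepth R A t) : IsExtDepth R B t :=
  ⟨fun i hi ↦ (subsingleton_ext_congr i e).1 (h.1 i hi),
    fun hB ↦ h.2 ((subsingleton_ext_congr t e).2 hB)⟩

lemma IsExtDepth.unique {s t : ℕ} (hs : IsExtDepth R A s) (ht : IsExtDepth R A t) : s = t := by
  rcases lt_trichotomy s t with h | h | h
  · exact (hs.2 (ht.1 s h)).elim
  · exact h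
  · exact (ht.2 (hs.1 t h)).elim

lemma IsExtDepth.nontrivial {t : ℕ} (h : IsExtDepth R A t) : Nontrivial A := by
  by_contra hA
  rw [not_nontrivial_iff_subsingleton] at hA
  refine h.2 (subsingleton_of_forall_eq 0 fun x ↦ ?_)
  rw [← extMap_id t x, Subsingleton.elim LinearMap.id (0 : A →ₗ[R] A), extMap_zero,
    AddMonoidHom.zero_apply]

/-- Depth drops by one along a short exact sequence whose first map vanishes on the first
nonzero `Ext` module of the left hand term. -/
lemma IsExtDepth.of_exact {f : A →ₗ[R] B} {g : B →ₗ[R] C} (hf : Function.Injective f)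
    (hfg : Function.Exact f g) (hg : Function.Surjective g) {a : ℕ} (ha : IsExtDepth R A a)
    (hB : ∀ i < a, Subsingleton (Ext (residueFieldModule R) (ModuleCat.of R B) i))
    (h0 : extMap a f = 0) : ∃ s, a = s + 1 ∧ IsExtDepth R C s := by
  let S : ShortComplex (ModuleCat R) :=
    ModuleCat.shortComplexOfCompEqZero f g hfg.linearMap_comp_eq_zero
  have hS : S.ShortExact :=
    { exact := (ShortComplex.ShortExact.moduleCat_exact_iff_function_exact _).mpr hfg
      mono_f := (ModuleCat.mono_iff_injective _).mpr hf
      epi_g := (ModuleCat.epi_iff_surjective _).mpr hg }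
  cases a with
  | zero =>
    refine (ha.2 (subsingleton_of_forall_eq 0 fun x ↦ ?_)).elim
    have := hS.mono_f
    exact Ext.postcomp_mk₀_injective_of_mono (residueFieldModule R) S.f
      ((DFunLike.congr_fun h0 x).trans (map_zero _).symm)
  | succ s =>
    refine ⟨s, rfl, fun i hi ↦ subsingleton_of_forall_eq 0 fun x ↦ ?_, fun hC ↦ ?_⟩
    · have hA := ha.1 (i + 1) (by omega)
      obtain ⟨y, rfl⟩ := Ext.covariant_sequence_exact₃ (residueFieldModule R) hS x rfl
        (hA.elim _ _)
      rw [(hB i (by omega)).elim y 0, Ext.zero_comp]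
    · refine ha.2 (subsingleton_of_forall_eq 0 fun x ↦ ?_)
      obtain ⟨y, rfl⟩ := Ext.covariant_sequence_exact₁ (residueFieldModule R) hS x
        (DFunLike.congr_fun h0 x) (n₀ := s) rfl
      rw [hC.elim y 0, Ext.zero_comp]

lemma subsingleton_ext_tensor_of_free (F N : Type) [AddCommGroup F] [Module R F] [Module.Free R F]
    [Module.Finite R F] [AddCommGroup N] [Module R N] (i : ℕ)
    (h : Subsingleton (Ext (residueFieldModule R) (ModuleCat.of R N) i)) :
    Subsingleton (Ext (residueFieldModule R) (ModuleCat.of R (F ⊗[R] N)) i) := by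
  let b := Module.Free.chooseBasis R F
  have hid : (LinearMap.id : F ⊗[R] N →ₗ[R] F ⊗[R] N) =
      ∑ j, (TensorProduct.mk R F N (b j)) ∘ₗ
        ((TensorProduct.lid R N).toLinearMap ∘ₗ (b.coord j).rTensor N) := by
    ext x y
    simp only [TensorProduct.AlgebraTensorModule.curry_apply, LinearMap.restrictScalars_self,
      TensorProduct.curry_apply, LinearMap.id_coe, id_eq, LinearMap.coe_sum, Finset.sum_apply,
      LinearMap.comp_apply, LinearMap.rTensor_tmul, LinearEquiv.coe_coe, TensorProduct.lid_tmul,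
      TensorProduct.mk_apply, Module.Basis.coord_apply]
    conv_lhs => rw [← b.sum_repr x, TensorProduct.sum_tmul]
    simp [TensorProduct.smul_tmul]
  refine subsingleton_of_forall_eq 0 fun x ↦ ?_
  rw [← extMap_id i x, hid, extMap_sum, AddMonoidHom.finsetSum_apply]
  refine Finset.sum_eq_zero fun j _ ↦ ?_
  rw [extMap_comp, h.elim (extMap i _ x) 0, map_zero]

lemma IsExtDepth.tensor_of_free (F N : Type) [AddCommGroup F] [Module R F] [Module.Free R F]
    [Module.Finite R F] [Nontrivial F] [AddCommGroup N] [Module R N] {t : ℕ}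
    (h : IsExtDepth R N t) : IsExtDepth R (F ⊗[R] N) t := by
  refine ⟨fun i hi ↦ subsingleton_ext_tensor_of_free F N i (h.1 i hi), fun hF ↦ h.2 ?_⟩
  let b := Module.Free.chooseBasis R F
  obtain ⟨j⟩ : Nonempty (Module.Free.ChooseBasisIndex R F) := b.index_nonempty
  refine subsingleton_ext_of_leftInverse t (TensorProduct.mk R F N (b j))
    ((TensorProduct.lid R N).toLinearMap ∘ₗ (b.coord j).rTensor N) ?_ hF
  ext x
  simp

lemma isExtDepth_moduleDepth [IsNoetherianRing R] (M : Type) [AddCommGroup M] [Module R M]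
    [Module.Finite R M] [Nontrivial M] : IsExtDepth R M (moduleDepth R M) := by
  have hsupp : Module.support R (residueFieldModule R) =
      PrimeSpectrum.zeroLocus (IsLocalRing.maximalIdeal R) := by
    rw [Module.support_eq_zeroLocus, Ideal.annihilator_quotient]
  have hlt : IsLocalRing.maximalIdeal R • (⊤ : Submodule R (ModuleCat.of R M)) < ⊤ :=
    lt_top_iff_ne_top.2 (Submodule.top_ne_ideal_smul_of_le_jacobson_annihilator
      (IsLocalRing.maximalIdeal_le_jacobson _)).symm
  let s : Set ℕ := {n : ℕ | ∃ rs : List R, rs.length = n ∧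
    (∀ r ∈ rs, r ∈ IsLocalRing.maximalIdeal R) ∧ RingTheory.Sequence.IsRegular M rs}
  have hs : ∀ n, n ∈ s ↔ ∀ i < n,
      Subsingleton (Ext (residueFieldModule R) (ModuleCat.of R M) i) := by
    intro n
    constructor
    · rintro ⟨rs, rfl, hm, hr⟩
      exact ModuleCat.subsingleton_ext_of_exists_isRegular (IsLocalRing.maximalIdeal R)
        (residueFieldModule R) hsupp.subset (ModuleCat.of R M) hlt rs hm hr
    · exact ModuleCat.exists_isRegular_of_exists_subsingleton_ext _ n (ModuleCat.of R M) hlt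
        (residueFieldModule R) hsupp
  have hbdd : BddAbove s := by
    obtain ⟨d, hd⟩ : ∃ d : ℕ, ringKrullDim R ≤ d := by
      obtain ⟨d, hd⟩ := WithBot.ne_bot_iff_exists.1 (ringKrullDim_ne_bot (R := R))
      have h2 := ringKrullDim_lt_top (R := R)
      rw [← hd] at h2
      obtain ⟨e, rfl⟩ := ENat.ne_top_iff_exists.1 (WithBot.coe_lt_coe.1 h2).ne
      exact ⟨e, hd.ge⟩
    refine ⟨d, ?_⟩
    rintro _ ⟨rs, rfl, -, hr⟩
    have h1 := Module.supportDim_add_length_eq_supportDim_of_isRegular rs hr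
    have h2 := (Module.supportDim_le_ringKrullDim R M).trans hd
    rw [← h1] at h2
    have := hr.quot_ofList_smul_nontrivial ⊤
    obtain ⟨c, hc⟩ := WithBot.ne_bot_iff_exists.1 (Module.supportDim_ne_bot_of_nontrivial R
      (M ⧸ Ideal.ofList rs • (⊤ : Submodule R M)))
    rw [← hc] at h2
    have h3 : c + (rs.length : ℕ∞) ≤ (d : ℕ∞) := by exact_mod_cast h2
    exact_mod_cast le_add_self.trans h3
  have hmem : moduleDepth R M ∈ s := Nat.sSup_mem ⟨0, (hs 0).2 (by simp)⟩ hbdd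
  refine ⟨(hs _).1 hmem, fun h ↦ ?_⟩
  have : moduleDepth R M + 1 ∈ s := (hs _).2 fun i hi ↦ by
    rcases Nat.lt_succ_iff_lt_or_eq.1 hi with h' | rfl
    · exact (hs _).1 hmem i h'
    · exact h
  exact absurd (le_csSup hbdd this) (by simp [moduleDepth, s])

end ExtResidueField

section Tor

variable {R : Type} [CommRing R]

/-- The vanishing of a positive `Tor` module expressed through a projective resolution of the
second variable. -/
lemma subsingleton_torMod_succ_iff (M N : Type) [AddCommGroup M] [Module R M] [AddCommGroup N]
    [Module R N] (P : ProjectiveResolution (ModuleCat.of R N)) (i : ℕ) :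
    Subsingleton (torMod R (i + 1) M N) ↔
      Function.Exact ((P.complex.d (i + 2) (i + 1)).hom.lTensor M)
        ((P.complex.d (i + 1) i).hom.lTensor M) := by
  let F := (MonoidalCategory.tensoringLeft (ModuleCat R)).obj (ModuleCat.of R M)
  let K := (F.mapHomologicalComplex _).obj P.complex
  have e : torMod R (i + 1) M N ≃ₗ[R] K.homology (i + 1) :=
    (P.isoLeftDerivedObj F (i + 1)).toLinearEquiv
  rw [e.toEquiv.subsingleton_congr, ← ModuleCat.isZero_iff_subsingleton,
    ← HomologicalComplex.exactAt_iff_isZero_homology,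
    HomologicalComplex.exactAt_iff' K (i + 2) (i + 1) i (by simp) (by simp),
    ShortComplex.ShortExact.moduleCat_exact_iff_function_exact]
  rfl

section Chase

variable {K F M : Type} [AddCommGroup K] [Module R K] [AddCommGroup F] [Module R F]
  [AddCommGroup M] [Module R M] {f : K →ₗ[R] F} {q : F →ₗ[R] M}
  {P₀ P₁ P₂ : Type} [AddCommGroup P₀] [Module R P₀] [AddCommGroup P₁] [Module R P₁]
  [AddCommGroup P₂] [Module R P₂] {d₁ : P₁ →ₗ[R] P₀} {d₂ : P₂ →ₗ[R] P₁}

lemma rTensor_lTensor_comm_apply (f : K →ₗ[R] F) (d : P₁ →ₗ[R] P₀) (x : K ⊗[R] P₁) :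
    f.rTensor P₀ (d.lTensor K x) = d.lTensor F (f.rTensor P₁ x) := by
  rw [← LinearMap.comp_apply, ← LinearMap.comp_apply, LinearMap.rTensor_comp_lTensor,
    LinearMap.lTensor_comp_rTensor]

/-- In the short exact sequence of complexes `0 → K ⊗ P → F ⊗ P → M ⊗ P → 0`, a boundary of
`F ⊗ P` which lies in `K ⊗ P` is already a boundary there, provided that the homology of `M ⊗ P`
vanishes. -/
lemma mem_range_lTensor_of_rTensor_mem_range [Module.Flat R P₀]
    (hf : Function.Injective f) (hfq : Function.Exact f q) (hq : Function.Surjective q)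
    (hd : d₁ ∘ₗ d₂ = 0) (hM : Function.Exact (d₂.lTensor M) (d₁.lTensor M))
    {y : K ⊗[R] P₀} {z : F ⊗[R] P₁} (hyz : d₁.lTensor F z = f.rTensor P₀ y) :
    ∃ w, d₁.lTensor K w = y := by
  have hq0 : (d₁.lTensor M) (q.rTensor P₁ z) = 0 := by
    rw [← rTensor_lTensor_comm_apply, hyz, ← LinearMap.comp_apply, ← LinearMap.rTensor_comp,
      hfq.linearMap_comp_eq_zero, LinearMap.rTensor_zero, LinearMap.zero_apply]
  obtain ⟨u, hu⟩ := (hM _).1 hq0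
  obtain ⟨v, rfl⟩ := LinearMap.rTensor_surjective P₂ hq u
  rw [← rTensor_lTensor_comm_apply q d₂ v, ← sub_eq_zero, ← map_sub] at hu
  obtain ⟨w, hw⟩ := (rTensor_exact P₁ hfq hq _).1 hu
  refine ⟨-w, Module.Flat.rTensor_preserves_injective_linearMap (M := P₀) f hf ?_⟩
  rw [rTensor_lTensor_comm_apply, map_neg, hw, neg_sub, map_sub, hyz, ← LinearMap.comp_apply,
    ← LinearMap.lTensor_comp, hd, LinearMap.lTensor_zero, LinearMap.zero_apply, sub_zero]

end Chase

/-- Dimension shifting: if the positive `Tor` modules of `M` and `N` vanish, then so do those of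
a syzygy of `M` and `N`, and tensoring the presentation with `N` is exact. -/
lemma torMod_syzygy (K F M N : Type) [AddCommGroup K] [Module R K] [AddCommGroup F] [Module R F]
    [AddCommGroup M] [Module R M] [AddCommGroup N] [Module R N] [Module.Flat R F]
    {f : K →ₗ[R] F} {q : F →ₗ[R] M}
    (hf : Function.Injective f) (hfq : Function.Exact f q) (hq : Function.Surjective q)
    (h : ∀ i : ℕ, 1 ≤ i → Subsingleton (torMod R i M N)) :
    Function.Injective (f.rTensor N) ∧ ∀ i : ℕ, 1 ≤ i → Subsingleton (torMod R i K N) := by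
  let P := projectiveResolution (ModuleCat.of R N)
  have hflat (i : ℕ) : Module.Flat R (P.complex.X i) := by
    have : Module.Projective R (P.complex.X i) := (IsProjective.iff_projective _).2 (P.projective i)
    infer_instance
  have hM (i : ℕ) := (subsingleton_torMod_succ_iff M N P i).1 (h (i + 1) (by omega))
  have hd (i : ℕ) : (P.complex.d (i + 1) i).hom ∘ₗ (P.complex.d (i + 2) (i + 1)).hom = 0 := by
    rw [← ModuleCat.hom_comp, P.complex.d_comp_d, ModuleCat.hom_zero]
  constructor
  · let ε : P.complex.X 0 →ₗ[R] N := (P.π.f 0).hom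
    have hε : Function.Surjective ε :=
      (ModuleCat.epi_iff_surjective (P.π.f 0)).1 inferInstance
    have hex : Function.Exact (P.complex.d 1 0).hom ε :=
      (ShortComplex.ShortExact.moduleCat_exact_iff_function_exact _).1 P.exact₀
    rw [injective_iff_map_eq_zero]
    intro x hx
    obtain ⟨y, rfl⟩ := LinearMap.lTensor_surjective K hε x
    rw [rTensor_lTensor_comm_apply] at hx
    obtain ⟨z, hz⟩ := (lTensor_exact F hex hε _).1 hx
    obtain ⟨w, rfl⟩ := mem_range_lTensor_of_rTensor_mem_range hf hfq hq (hd 0) (hM 0) hz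
    exact (lTensor_exact K hex hε).apply_apply_eq_zero w
  · intro i hi
    obtain ⟨i, rfl⟩ := Nat.exists_eq_add_of_le' hi
    refine (subsingleton_torMod_succ_iff K N P i).2 fun y ↦ ⟨fun hy ↦ ?_, ?_⟩
    · have hex : Function.Exact (P.complex.d (i + 2) (i + 1)).hom (P.complex.d (i + 1) i).hom :=
        (ShortComplex.ShortExact.moduleCat_exact_iff_function_exact _).1 (P.exact_succ i)
      have h0 : (P.complex.d (i + 1) i).hom.lTensor F (f.rTensor _ y) = 0 := by
        rw [← rTensor_lTensor_comm_apply, hy, map_zero]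
      obtain ⟨z, hz⟩ := (Module.Flat.lTensor_exact F hex _).1 h0
      exact mem_range_lTensor_of_rTensor_mem_range hf hfq hq (hd (i + 1)) (hM (i + 1)) hz
    · rintro ⟨w, rfl⟩
      rw [← LinearMap.comp_apply, ← LinearMap.lTensor_comp, hd, LinearMap.lTensor_zero,
        LinearMap.zero_apply]

end Tor

section ProjectiveDimension

variable {R : Type} [CommRing R]

lemma HasFiniteProjDim.exists_hasProjectiveDimensionLT {M : Type} [AddCommGroup M] [Module R M]
    (h : HasFiniteProjDim R M) :
    ∃ n : ℕ, HasProjectiveDimensionLT (ModuleCat.of R M) (n + 1) := by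
  obtain ⟨n, P, d, ε, hε, hdε, hd, hP, hn⟩ := h
  refine ⟨n, ?_⟩
  induction n generalizing M P with
  | zero =>
    have h1 := hn 1 one_pos
    have hinj : Function.Injective ε := by
      refine (injective_iff_map_eq_zero ε.hom).2 fun x hx ↦ ?_
      obtain ⟨y, rfl⟩ := (hdε x).1 hx
      rw [Subsingleton.elim y 0]
      exact map_zero (d 0).hom
    let e : P 0 ≅ ModuleCat.of R M := (LinearEquiv.ofBijective ε.hom ⟨hinj, hε⟩).toModuleIso
    exact projective_iff_hasProjectiveDimensionLT_one.1 (Projective.of_iso e (hP 0))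
  | succ n ih =>
    let S := ε.hom.shortComplexKer
    have hS : S.ShortExact := LinearMap.shortExact_shortComplexKer hε
    refine (hS.hasProjectiveDimensionLT_X₃_iff n (hP 0)).2 ?_
    let ε' : P 1 →ₗ[R] LinearMap.ker ε.hom :=
      (d 0).hom.codRestrict _ fun x ↦ (hdε _).2 ⟨x, rfl⟩
    refine ih (fun i ↦ P (i + 1)) (fun i ↦ d (i + 1)) (ModuleCat.ofHom ε') ?_ ?_
      (fun i ↦ hd (i + 1)) (fun i ↦ hP (i + 1)) (fun i hi ↦ hn (i + 1) (by omega))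
    · rintro ⟨x, hx⟩
      obtain ⟨y, hy⟩ := (hdε x).1 hx
      exact ⟨y, Subtype.ext hy⟩
    · intro x
      refine Iff.trans ?_ (hd 0 x)
      exact Subtype.ext_iff

lemma mem_smul_top_of_forall_mem {K : Type} [AddCommGroup K] [Module R K] [Module.Free R K]
    [Module.Finite R K] {n : ℕ} (I : Ideal R) (f : K →ₗ[R] (Fin n → R))
    (h : ∀ x i, f x i ∈ I) : f ∈ I • (⊤ : Submodule R (K →ₗ[R] (Fin n → R))) := by
  let b := Module.Free.chooseBasis R K
  have hf : f = ∑ j, ∑ i, f (b j) i • (b.coord j).smulRight (Pi.single i (1 : R)) := by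
    refine b.ext fun l ↦ ?_
    rw [LinearMap.sum_apply, Finset.sum_eq_single l]
    · conv_lhs => rw [pi_eq_sum_univ' (f (b l))]
      simp
    · intro c _ hc
      simp [hc.symm]
    · simp
  rw [hf]
  exact Submodule.sum_mem _ fun j _ ↦ Submodule.sum_mem _ fun i _ ↦
    Submodule.smul_mem_smul (h _ _) trivial

variable [IsLocalRing R]

/-- A finitely generated module over a local ring has a minimal free cover. -/
lemma exists_minimal_free_cover (M : Type) [AddCommGroup M] [Module R M] [Module.Finite R M] :
    ∃ (n : ℕ) (q : (Fin n → R) →ₗ[R] M), Function.Surjective q ∧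
      ∀ x, q x = 0 → ∀ i, x i ∈ IsLocalRing.maximalIdeal R := by
  let k := IsLocalRing.ResidueField R
  let b := Module.finBasis k (k ⊗[R] M)
  obtain ⟨v, hv⟩ := (TensorProduct.mk_surjective R M k
    Ideal.Quotient.mk_surjective).comp_left b
  have hspan := IsLocalRing.span_eq_top_of_tmul_eq_basis v b fun i ↦ congr_fun hv i
  refine ⟨_, Fintype.linearCombination R v, ?_, fun x hx i ↦ ?_⟩
  · rw [← LinearMap.range_eq_top, Fintype.range_linearCombination, hspan]
  · have h0 : ∑ j, (IsLocalRing.residue R (x j)) • b j = 0 := by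
      rw [← (TensorProduct.mk R k M 1).map_zero, ← hx, Fintype.linearCombination_apply, map_sum]
      refine Finset.sum_congr rfl fun j _ ↦ ?_
      rw [← congr_fun hv j, map_smul]
      exact algebraMap_smul k (x j) _
    have := Fintype.linearIndependent_iff.1 b.linearIndependent _ h0 i
    rwa [IsLocalRing.residue_eq_zero_iff] at this

lemma extMap_rTensor_eq_zero {K N : Type} [AddCommGroup K] [Module R K] [Module.Free R K]
    [Module.Finite R K] [AddCommGroup N] [Module R N] {n : ℕ} (f : K →ₗ[R] (Fin n → R))
    (h : ∀ x i, f x i ∈ IsLocalRing.maximalIdeal R) (t : ℕ) :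
    extMap t (f.rTensor N) = 0 := by
  refine extMap_eq_zero_of_mem_smul_top t _ ?_
  have := Submodule.mem_map_of_mem (f := LinearMap.rTensorHom N)
    (mem_smul_top_of_forall_mem _ f h)
  rw [Submodule.map_smul''] at this
  exact Submodule.smul_mono le_rfl le_top this

variable [IsNoetherianRing R]

/-- For a module `M` of finite projective dimension over a Noetherian local ring there is a number
`p`, namely the projective dimension of `M`, such that `depth (M ⊗ N) = depth N - p` for every
`N` whose positive `Tor` modules with `M` vanish. -/
lemma exists_depth_tensor_add_eq (n : ℕ) (M : Type) [AddCommGroup M] [Module R M]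
    [Module.Finite R M] [Nontrivial M]
    (hM : HasProjectiveDimensionLT (ModuleCat.of R M) (n + 1)) :
    ∃ p : ℕ, (p = 0 → Module.Free R M) ∧ ∀ (N : Type) [AddCommGroup N] [Module R N],
      (∀ i : ℕ, 1 ≤ i → Subsingleton (torMod R i M N)) → ∀ t, IsExtDepth R N t →
        ∃ s, t = p + s ∧ IsExtDepth R (M ⊗[R] N) s := by
  induction n generalizing M with
  | zero =>
    have : Module.Projective R M :=
      (IsProjective.iff_projective _).2 (projective_iff_hasProjectiveDimensionLT_one.2 hM)
    have : Module.Free R M := Module.free_of_flat_of_isLocalRing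
    exact ⟨0, fun _ ↦ this, fun N _ _ _ t ht ↦ ⟨t, (zero_add t).symm, ht.tensor_of_free M N⟩⟩
  | succ n ih =>
    by_cases hfree : Module.Free R M
    · exact ⟨0, fun _ ↦ hfree, fun N _ _ _ t ht ↦ ⟨t, (zero_add t).symm, ht.tensor_of_free M N⟩⟩
    obtain ⟨r, q, hq, hmin⟩ := exists_minimal_free_cover (R := R) M
    let K := LinearMap.ker q
    let f : K →ₗ[R] (Fin r → R) := K.subtype
    have hf : Function.Injective f := K.injective_subtype
    have hfq : Function.Exact f q := LinearMap.exact_subtype_ker_map q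
    have hK : Nontrivial K := by
      by_contra hK
      have hbot : LinearMap.ker q = ⊥ := by
        rwa [Submodule.nontrivial_iff_ne_bot, not_not] at hK
      exact hfree (Module.Free.of_equiv
        (LinearEquiv.ofBijective q ⟨LinearMap.ker_eq_bot.1 hbot, hq⟩))
    have hr : Nontrivial (Fin r → R) := hf.nontrivial
    have hKpd : HasProjectiveDimensionLT (ModuleCat.of R K) (n + 1) :=
      ((LinearMap.shortExact_shortComplexKer hq).hasProjectiveDimensionLT_X₃_iff n
        (ModuleCat.projective_of_free (Pi.basisFun R (Fin r)))).1 hM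
    obtain ⟨p, hp, hdepth⟩ := ih K hKpd
    refine ⟨p + 1, by simp, fun N _ _ htor t ht ↦ ?_⟩
    obtain ⟨hinj, htorK⟩ := torMod_syzygy K (Fin r → R) M N hf hfq hq htor
    obtain ⟨a, rfl, ha⟩ := hdepth N htorK t ht
    have hB (i : ℕ) (hi : i < p + a) :=
      subsingleton_ext_tensor_of_free (Fin r → R) N i (ht.1 i hi)
    have h0 : extMap (A := K ⊗[R] N) (B := (Fin r → R) ⊗[R] N) a (f.rTensor N) = 0 := by
      rcases Nat.eq_zero_or_pos p with hp0 | hp0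
      · have := hp hp0
        exact extMap_rTensor_eq_zero f (fun x i ↦ hmin x x.2 i) a
      · have := hB a (by omega)
        ext x
        exact Subsingleton.elim _ _
    obtain ⟨s, rfl, hs⟩ := ha.of_exact hinj (rTensor_exact N hfq hq)
      (LinearMap.rTensor_surjective N hq) (fun i hi ↦ hB i (by omega)) h0
    exact ⟨s, by omega, hs⟩

end ProjectiveDimension

/-- **Auslander's depth formula.** If `R` is a commutative Noetherian local ring,
`M` and `N` are nonzero finitely generated `R`-modules, `M` has finite projective
dimension, and `Tor_i^R(M, N) = 0` for all `i ≥ 1`, then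
`depth M + depth N = depth R + depth (M ⊗_R N)`. -/
theorem depth_formula_of_hasFiniteProjDim
    (R : Type) [CommRing R] [IsNoetherianRing R] [IsLocalRing R]
    (M N : Type) [AddCommGroup M] [Module R M] [AddCommGroup N] [Module R N]
    [Module.Finite R M] [Module.Finite R N] [Nontrivial M] [Nontrivial N]
    (hpd : HasFiniteProjDim R M)
    (htor : ∀ i : ℕ, 1 ≤ i → Subsingleton (torMod R i M N)) :
    moduleDepth R M + moduleDepth R N =
      moduleDepth R R + moduleDepth R (TensorProduct R M N) := by
  obtain ⟨n, hn⟩ := hpd.exists_hasProjectiveDimensionLT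
  obtain ⟨p, -, hp⟩ := exists_depth_tensor_add_eq n M hn
  have htorR (i : ℕ) (hi : 1 ≤ i) : Subsingleton (torMod R i M R) := by
    obtain ⟨i, rfl⟩ := Nat.exists_eq_add_of_le' hi
    have : Projective (ModuleCat.of R R) := 
      ModuleCat.projective_of_free (Module.Basis.singleton Unit R)
    exact ModuleCat.isZero_iff_subsingleton.1
      (isZero_Tor_succ_of_projective (ModuleCat R) (ModuleCat.of R M) (ModuleCat.of R R) i)
  obtain ⟨s, hs, hs'⟩ := hp N htor _ (isExtDepth_moduleDepth N)
  obtain ⟨u, hu, hu'⟩ := hp R htorR _ (isExtDepth_moduleDepth R)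
  have hMu := (isExtDepth_moduleDepth M).unique (hu'.congr (TensorProduct.rid R M))
  have : Nontrivial (M ⊗[R] N) := hs'.nontrivial
  have hMNs := (isExtDepth_moduleDepth (M ⊗[R] N)).unique hs'
  omega
end

section
/- Let R be a commutative Noetherian local ring and let X and Y be nonzero finitely generated R-modules such that Ext^i_R(X,Y) = 0 for all i ≥ 1. Then depth_R(Hom_R(X,Y)) = depth_R(Y). -/
open CategoryTheory

/-- The `i`-th Ext module `Ext^i_R(X, Y)` of two `R`-modules. -/
noncomputable abbrev extMod (R : Type) [CommRing R] (i : ℕ)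
    (X : Type) [AddCommGroup X] [Module R X]
    (Y : Type) [AddCommGroup Y] [Module R Y] : Type :=
  ((Ext R (ModuleCat R) i).obj (Opposite.op (ModuleCat.of R X))).obj (ModuleCat.of R Y)

/-- The existence of an `M`-regular sequence of length `n` in the maximal ideal. -/
def HasRegularSequence (R : Type) [CommRing R] [IsLocalRing R]
    (M : Type) [AddCommGroup M] [Module R M] (n : ℕ) : Prop :=
  ∃ rs : List R, rs.length = n ∧
    (∀ r ∈ rs, r ∈ IsLocalRing.maximalIdeal R) ∧ RingTheory.Sequence.IsRegular M rs

section ExtComparison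

open scoped Pointwise

variable {R : Type} [CommRing R]

theorem subsingleton_abelianExt_of_subsingleton_ext (X Y : ModuleCat.{0} R) (n : ℕ)
    (h : Subsingleton (((Ext R (ModuleCat R) (n + 1)).obj (Opposite.op X)).obj Y)) :
    Subsingleton (Abelian.Ext X Y (n + 1)) := by
  let P := projectiveResolution X
  have hz : Limits.IsZero ((P.complex.linearYonedaObj R Y).homology (n + 1)) :=
    (@ModuleCat.isZero_of_subsingleton _ _ _ h).of_iso (P.isoExt (n + 1) Y).symm
  rw [← HomologicalComplex.exactAt_iff_isZero_homology,
    HomologicalComplex.exactAt_iff' _ n (n + 1) (n + 2) (by simp) (by simp),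
    ShortComplex.moduleCat_exact_iff] at hz
  refine subsingleton_of_forall_eq 0 fun α ↦ ?_
  obtain ⟨f, hf, rfl⟩ := P.extMk_surjective α (n + 2) rfl
  rw [P.extMk_eq_zero_iff f (n + 2) rfl hf n rfl]
  exact hz f hf

variable {X Y : Type} [AddCommGroup X] [Module R X] [AddCommGroup Y] [Module R Y]

theorem subsingleton_ext_quotSMulTop (N : ModuleCat.{0} R) {x : R} (hx : IsSMulRegular Y x)
    (i : ℕ) (h₁ : Subsingleton (Abelian.Ext N (ModuleCat.of R Y) i))
    (h₂ : Subsingleton (Abelian.Ext N (ModuleCat.of R Y) (i + 1))) :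
    Subsingleton (Abelian.Ext N (ModuleCat.of R (QuotSMulTop x Y)) i) := by
  have hS : (ModuleCat.smulShortComplex (ModuleCat.of R Y) x).ShortExact :=
    IsSMulRegular.smulShortComplex_shortExact hx
  refine subsingleton_of_forall_eq 0 fun α ↦ ?_
  obtain ⟨β, hβ⟩ := Abelian.Ext.covariant_sequence_exact₃ N hS α rfl
    (h₂.elim _ _)
  obtain rfl : β = 0 := h₁.elim β 0
  rw [← hβ, Abelian.Ext.zero_comp]
  rfl

theorem compRight_mkQ_surjective {x : R} (hx : IsSMulRegular Y x)
    (h : Subsingleton (Abelian.Ext (ModuleCat.of R X) (ModuleCat.of R Y) 1)) :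
    Function.Surjective
      (LinearMap.compRight R (M := X) (x • (⊤ : Submodule R Y)).mkQ) := by
  intro f
  have hS : (ModuleCat.smulShortComplex (ModuleCat.of R Y) x).ShortExact :=
    IsSMulRegular.smulShortComplex_shortExact hx
  let f' : ModuleCat.of R X ⟶ (ModuleCat.smulShortComplex (ModuleCat.of R Y) x).X₃ :=
    ModuleCat.ofHom f
  obtain ⟨β, hβ⟩ := Abelian.Ext.covariant_sequence_exact₃ _ hS (Abelian.Ext.mk₀ f') rfl
    (h.elim _ _)
  obtain ⟨g, rfl⟩ := (Abelian.Ext.mk₀_bijective _ _).2 β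
  rw [Abelian.Ext.mk₀_comp_mk₀] at hβ
  have := (Abelian.Ext.mk₀_bijective _ _).1 hβ
  exact ⟨g.hom, congrArg ModuleCat.Hom.hom this⟩

theorem ker_compRight_mkQ {x : R} (hx : IsSMulRegular Y x) :
    LinearMap.ker (LinearMap.compRight R (M := X) (x • (⊤ : Submodule R Y)).mkQ) =
      x • (⊤ : Submodule R (X →ₗ[R] Y)) := by
  ext f
  rw [LinearMap.mem_ker, Submodule.mem_smul_pointwise_iff_exists]
  constructor
  · intro hf
    have hinj : Function.Injective (LinearMap.lsmul R Y x) := hx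
    have hrange (v : X) : f v ∈ LinearMap.range (LinearMap.lsmul R Y x) := by
      have : (x • (⊤ : Submodule R Y)).mkQ (f v) = 0 := LinearMap.congr_fun hf v
      rw [Submodule.mkQ_apply, Submodule.Quotient.mk_eq_zero,
        Submodule.mem_smul_pointwise_iff_exists] at this
      obtain ⟨y, -, hy⟩ := this
      exact ⟨y, hy⟩
    refine ⟨(LinearEquiv.ofInjective _ hinj).symm.toLinearMap ∘ₗ f.codRestrict _ hrange,
      trivial, ?_⟩
    ext v
    exact congrArg Subtype.val
      ((LinearEquiv.ofInjective _ hinj).apply_symm_apply (f.codRestrict _ hrange v))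
  · rintro ⟨g, -, rfl⟩
    ext v
    exact (Submodule.Quotient.mk_eq_zero _).mpr
      (Submodule.smul_mem_pointwise_smul _ _ _ trivial)

/-- If `Ext¹(X, Y) = 0` and `x` is `Y`-regular then `Hom(X, Y) / x ≃ Hom(X, Y / x)`. -/
noncomputable def quotSMulTopHomEquiv {x : R} (hx : IsSMulRegular Y x)
    (h : Subsingleton (Abelian.Ext (ModuleCat.of R X) (ModuleCat.of R Y) 1)) :
    QuotSMulTop x (X →ₗ[R] Y) ≃ₗ[R] (X →ₗ[R] QuotSMulTop x Y) :=
  (Submodule.quotEquivOfEq _ _ (ker_compRight_mkQ hx).symm).trans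
    (LinearMap.quotKerEquivOfSurjective _ (compRight_mkQ_surjective hx h))

theorem IsSMulRegular.linearMap {x : R} (hx : IsSMulRegular Y x) :
    IsSMulRegular (X →ₗ[R] Y) x :=
  fun _ _ h ↦ LinearMap.ext fun v ↦ hx (LinearMap.congr_fun h v)

end ExtComparison

section Local

open IsLocalRing

variable {R : Type} [CommRing R] [IsLocalRing R]

theorem HasRegularSequence.congr {M N : Type} [AddCommGroup M] [Module R M] [AddCommGroup N]
    [Module R N] (e : M ≃ₗ[R] N) (n : ℕ) :
    HasRegularSequence R M n ↔ HasRegularSequence R N n := by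
  simp only [HasRegularSequence, e.isRegular_congr]

theorem hasRegularSequence_zero (M : Type) [AddCommGroup M] [Module R M] [Nontrivial M] :
    HasRegularSequence R M 0 :=
  ⟨[], rfl, by simp, RingTheory.Sequence.IsRegular.nil R M⟩

theorem HasRegularSequence.exists_isSMulRegular {M : Type} [AddCommGroup M] [Module R M] {n : ℕ}
    (h : HasRegularSequence R M (n + 1)) : ∃ x ∈ maximalIdeal R, IsSMulRegular M x := by
  obtain ⟨_ | ⟨x, rs⟩, hlen, hmem, hreg⟩ := h
  · simp at hlen
  · exact ⟨x, hmem x List.mem_cons_self,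
      ((RingTheory.Sequence.isRegular_cons_iff M x rs).mp hreg).1⟩

variable [IsNoetherianRing R]

theorem hasRegularSequence_succ_iff {M : Type} [AddCommGroup M] [Module R M] [Module.Finite R M]
    [Nontrivial M] {x : R} (hxm : x ∈ maximalIdeal R) (hx : IsSMulRegular M x) (n : ℕ) :
    HasRegularSequence R M (n + 1) ↔ HasRegularSequence R (QuotSMulTop x M) n := by
  have := nontrivial_quotSMulTop_of_mem_maximalIdeal M hxm
  have hlt (L : Type) [AddCommGroup L] [Module R L] [Module.Finite R L] [Nontrivial L] :
      maximalIdeal R • (⊤ : Submodule R L) < ⊤ :=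
    (Submodule.top_ne_ideal_smul_of_le_jacobson_annihilator
      (maximalIdeal_le_jacobson _)).symm.lt_top
  have hsupp : Module.support R (R ⧸ maximalIdeal R) =
      PrimeSpectrum.zeroLocus (maximalIdeal R) := by
    rw [Module.support_eq_zeroLocus, Ideal.annihilator_quotient]
  constructor
  · rintro ⟨rs, hlen, hmem, hreg⟩
    have hext := ModuleCat.subsingleton_ext_of_exists_isRegular (maximalIdeal R)
      (ModuleCat.of R (R ⧸ maximalIdeal R)) hsupp.subset (ModuleCat.of R M) (hlt M) rs hmem hreg
    exact ModuleCat.exists_isRegular_of_exists_subsingleton_ext (maximalIdeal R) n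
      (ModuleCat.of R (QuotSMulTop x M)) (hlt _) (ModuleCat.of R (R ⧸ maximalIdeal R)) hsupp
      fun i hi ↦ subsingleton_ext_quotSMulTop _ hx i (hext i (by omega))
        (hext (i + 1) (by omega))
  · rintro ⟨rs, hlen, hmem, hreg⟩
    exact ⟨x :: rs, by simp [hlen], List.forall_mem_cons.mpr ⟨hxm, hmem⟩, hreg.cons hx⟩

variable {X Y : Type} [AddCommGroup X] [Module R X] [AddCommGroup Y] [Module R Y]
  [Module.Finite R X] [Module.Finite R Y] [Nontrivial X]

theorem exists_linearMap_ne_zero_forall_smul_eq_zero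
    (hY : ¬ ∃ x ∈ maximalIdeal R, IsSMulRegular Y x) :
    ∃ f : X →ₗ[R] Y, f ≠ 0 ∧ ∀ r ∈ maximalIdeal R, r • f = 0 := by
  have hg : ¬ Subsingleton (R ⧸ maximalIdeal R →ₗ[R] Y) := by
    rwa [IsSMulRegular.subsingleton_linearMap_iff, Ideal.annihilator_quotient]
  have hφ : ¬ Subsingleton (X →ₗ[R] R ⧸ maximalIdeal R) := by
    rw [IsSMulRegular.subsingleton_linearMap_iff]
    rintro ⟨r, hr, hreg⟩
    have hrm : r ∈ maximalIdeal R := by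
      refine le_maximalIdeal (fun h ↦ ?_) hr
      exact not_subsingleton X (Module.annihilator_eq_top_iff.mp h)
    have h0 : r • (1 : R ⧸ maximalIdeal R) = r • 0 := by
      rw [smul_zero, Algebra.smul_def, mul_one]
      exact Ideal.Quotient.eq_zero_iff_mem.mpr hrm
    exact one_ne_zero (hreg h0)
  rw [not_subsingleton_iff_nontrivial] at hg hφ
  obtain ⟨g, hg⟩ := exists_ne (0 : R ⧸ maximalIdeal R →ₗ[R] Y)
  obtain ⟨φ, hφ⟩ := exists_ne (0 : X →ₗ[R] R ⧸ maximalIdeal R)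
  refine ⟨g ∘ₗ φ, fun h ↦ ?_, fun r hr ↦ ?_⟩
  · obtain ⟨v, hv⟩ := DFunLike.ne_iff.mp hφ
    obtain ⟨a, ha⟩ := Ideal.Quotient.mk_surjective (φ v)
    have hau : IsUnit a := by
      by_contra hu
      exact hv (ha.symm.trans (Ideal.Quotient.eq_zero_iff_mem.mpr hu))
    have hga : a • g 1 = 0 := by
      rw [← map_smul, Algebra.smul_def, mul_one]
      exact (congrArg g ha).trans (LinearMap.congr_fun h v)
    have hg1 : g 1 = 0 := hau.smul_eq_zero.mp hga
    apply hg
    ext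
    exact hg1
  · ext v
    have hrv : r • φ v = 0 := Module.mem_annihilator.mp
      ((Ideal.annihilator_quotient (I := maximalIdeal R)).symm ▸ hr) _
    simp [← map_smul g, hrv]

theorem hasRegularSequence_linearMap_iff_of_supportDim_lt [Nontrivial Y] (d : ℕ)
    (hd : Module.supportDim R Y < d)
    (hext : ∀ i : ℕ, Subsingleton
      (Abelian.Ext (ModuleCat.of R X) (ModuleCat.of R Y) (i + 1))) :
    Nontrivial (X →ₗ[R] Y) ∧
      ∀ n, HasRegularSequence R (X →ₗ[R] Y) n ↔ HasRegularSequence R Y n := by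
  induction d generalizing Y with
  | zero =>
    exact absurd hd (not_lt.mpr ((Order.krullDim_nonneg_iff).mpr
      (Module.nonempty_support_of_nontrivial (R := R) (M := Y)).to_subtype))
  | succ d ih =>
    by_cases hY : ∃ x ∈ maximalIdeal R, IsSMulRegular Y x
    · obtain ⟨x, hxm, hx⟩ := hY
      have := nontrivial_quotSMulTop_of_mem_maximalIdeal Y hxm
      have hdim : Module.supportDim R (QuotSMulTop x Y) < d := by
        have h := Module.supportDim_quotSMulTop_succ_eq_supportDim hx hxm
        rw [← h] at hd
        push_cast at hd
        exact lt_of_add_lt_add_right hd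
      obtain ⟨hnt, hiff⟩ := ih hdim fun i ↦
        subsingleton_ext_quotSMulTop _ hx (i + 1) (hext i) (hext (i + 1))
      let e := quotSMulTopHomEquiv hx (hext 0)
      have hnt' : Nontrivial (X →ₗ[R] Y) := by
        have := e.nontrivial
        exact (Submodule.mkQ_surjective _).nontrivial (β := QuotSMulTop x (X →ₗ[R] Y))
      refine ⟨hnt', fun n ↦ ?_⟩
      cases n with
      | zero => exact iff_of_true (hasRegularSequence_zero _) (hasRegularSequence_zero _)
      | succ n =>
        rw [hasRegularSequence_succ_iff hxm hx, hasRegularSequence_succ_iff hxm hx.linearMap,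
          HasRegularSequence.congr e, hiff]
    · obtain ⟨f, hf, hmf⟩ := exists_linearMap_ne_zero_forall_smul_eq_zero (X := X) hY
      have hnt : Nontrivial (X →ₗ[R] Y) := ⟨f, 0, hf⟩
      refine ⟨hnt, fun n ↦ ?_⟩
      cases n with
      | zero => exact iff_of_true (hasRegularSequence_zero _) (hasRegularSequence_zero _)
      | succ n =>
        refine iff_of_false (fun h ↦ ?_) fun h ↦ hY h.exists_isSMulRegular
        obtain ⟨x, hxm, hx⟩ := h.exists_isSMulRegular
        exact hf (hx ((hmf x hxm).trans (smul_zero x).symm))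

end Local

/-- If `R` is a commutative Noetherian local ring and `X`, `Y` are nonzero finitely
generated `R`-modules with `Ext^i_R(X, Y) = 0` for all `i ≥ 1`, then
`depth (Hom_R(X, Y)) = depth Y`. -/
theorem depth_hom_eq_depth_of_ext_vanishing
    (R : Type) [CommRing R] [IsNoetherianRing R] [IsLocalRing R]
    (X Y : Type) [AddCommGroup X] [Module R X] [AddCommGroup Y] [Module R Y]
    [Module.Finite R X] [Module.Finite R Y] [Nontrivial X] [Nontrivial Y]
    (hext : ∀ i : ℕ, 1 ≤ i → Subsingleton (extMod R i X Y)) :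
    moduleDepth R (X →ₗ[R] Y) = moduleDepth R Y := by
  have hfin : Module.supportDim R Y < ⊤ :=
    (Module.supportDim_le_ringKrullDim R Y).trans_lt ringKrullDim_lt_top
  obtain ⟨d, hd⟩ : ∃ d : ℕ, Module.supportDim R Y < d := by
    generalize Module.supportDim R Y = a at hfin
    induction a with
    | bot => exact ⟨0, WithBot.bot_lt_coe _⟩
    | coe a =>
      have ha : a ≠ ⊤ := by
        rintro rfl
        exact lt_irrefl _ hfin
      lift a to ℕ using ha
      exact ⟨a + 1, by exact_mod_cast a.lt_succ_self⟩
  have h := (hasRegularSequence_linearMap_iff_of_supportDim_lt (X := X) d hd fun i ↦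
    subsingleton_abelianExt_of_subsingleton_ext _ _ i (hext (i + 1) (by omega))).2
  exact congrArg sSup (Set.ext h)
end

section
/- Let R be a commutative Noetherian local ring, let M and N be finitely generated R-modules, and fix a resolution ⋯ → F_2 → F_1 → F_0 → M → 0 of M by finite free R-modules. For each integer n ≥ 1 there exist R-linear maps α, β, γ such that the sequence 0 → Ext^1_R(Tr Ω^n M, N) →(α) Tor_n^R(M,N) →(β) Hom_R(Ext^n_R(M,R), N) →(γ) Ext^2_R(Tr Ω^n M, N) is exact. -/
open CategoryTheory

/-- A resolution `⋯ → F_2 → F_1 → F_0 → M → 0` of `M` by finite free `R`-modules. -/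
structure FiniteFreeResolution (R : Type) [CommRing R]
    (M : Type) [AddCommGroup M] [Module R M] where
  F : ℕ → Type
  [addCommGroup : ∀ n, AddCommGroup (F n)]
  [module : ∀ n, Module R (F n)]
  free : ∀ n, Module.Free R (F n)
  finite : ∀ n, Module.Finite R (F n)
  d : ∀ n, F (n + 1) →ₗ[R] F n
  ε : F 0 →ₗ[R] M
  surj : Function.Surjective ε
  exact_at_zero : Function.Exact (d 0) ε
  exact_at : ∀ n, Function.Exact (d (n + 1)) (d n)

attribute [instance] FiniteFreeResolution.addCommGroup FiniteFreeResolution.module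

/-- `Tr Ω^n M`: the transpose of the `n`-th syzygy of `M` with respect to the given
finite free resolution, i.e. the cokernel of the dual map `F_n^* → F_{n+1}^*`.
(For `n = 0` this is the transpose `Tr M` of `M` itself.) -/
abbrev FiniteFreeResolution.trSyzygy {R : Type} [CommRing R] {M : Type}
    [AddCommGroup M] [Module R M] (res : FiniteFreeResolution R M) (n : ℕ) : Type :=
  Module.Dual R (res.F (n + 1)) ⧸ LinearMap.range (res.d n).dualMap

/-- The homology of a short complex of modules as a quotient of the module of cycles. -/
lemma CategoryTheory.ShortComplex.exists_surjective_to_homology {R : Type} [CommRing R]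
    (S : ShortComplex (ModuleCat.{0} R)) :
    ∃ p : LinearMap.ker S.g.hom →ₗ[R] S.homology, Function.Surjective p ∧
      ∀ x, p x = 0 ↔ ∃ y, S.f.hom y = x := by
  let e : S.homology ≃ₗ[R] LinearMap.ker S.g.hom ⧸ LinearMap.range S.moduleCatToCycles :=
    S.moduleCatHomologyIso.toLinearEquiv
  refine ⟨e.symm.toLinearMap ∘ₗ (LinearMap.range S.moduleCatToCycles).mkQ,
    e.symm.surjective.comp (Submodule.mkQ_surjective _), fun x => ?_⟩
  rw [LinearMap.comp_apply, LinearEquiv.coe_coe, LinearEquiv.map_eq_zero_iff,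
    Submodule.mkQ_apply, Submodule.Quotient.mk_eq_zero]
  constructor
  · rintro ⟨y, rfl⟩
    exact ⟨y, rfl⟩
  · rintro ⟨y, hy⟩
    exact ⟨y, Subtype.ext hy⟩

/-- Positive-degree Ext modules as quotients of the module of cocycles, computed with a
projective resolution. -/
lemma CategoryTheory.ProjectiveResolution.exists_cocycles_to_ext {R : Type} [CommRing R]
    {X : ModuleCat.{0} R} (P : ProjectiveResolution X) (Y : ModuleCat.{0} R) (n : ℕ) :
    ∃ p : LinearMap.ker (LinearMap.lcomp R Y (P.complex.d (n + 2) (n + 1)).hom) →ₗ[R]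
        ((Ext R (ModuleCat R) (n + 1)).obj (Opposite.op X)).obj Y,
      Function.Surjective p ∧
        ∀ x, p x = 0 ↔ ∃ y : P.complex.X n →ₗ[R] Y, y ∘ₗ (P.complex.d (n + 1) n).hom = x := by
  let C := P.complex.linearYonedaObj R Y
  obtain ⟨p, hp, hp0⟩ := (C.sc' n (n + 1) (n + 2)).exists_surjective_to_homology
  let e : ((Ext R (ModuleCat R) (n + 1)).obj (Opposite.op X)).obj Y ≅
      (C.sc' n (n + 1) (n + 2)).homology :=
    P.isoExt (n + 1) Y ≪≫
      ShortComplex.homologyMapIso (C.isoSc' n (n + 1) (n + 2) (by simp) (by simp))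
  let c : LinearMap.ker (LinearMap.lcomp R Y (P.complex.d (n + 2) (n + 1)).hom) ≃ₗ[R]
      LinearMap.ker (C.sc' n (n + 1) (n + 2)).g.hom :=
    (ModuleCat.homLinearEquiv (S := R)).symm.ofSubmodules _ _ (by
      ext x
      simp only [Submodule.mem_map, LinearMap.mem_ker]
      constructor
      · rintro ⟨y, hy, rfl⟩
        exact ModuleCat.hom_ext hy
      · intro hx
        exact ⟨x.hom, congrArg ModuleCat.Hom.hom hx, rfl⟩)
  refine ⟨e.toLinearEquiv.symm.toLinearMap ∘ₗ p ∘ₗ c.toLinearMap,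
    e.toLinearEquiv.symm.surjective.comp (hp.comp c.surjective), fun x => ?_⟩
  rw [LinearMap.comp_apply, LinearEquiv.coe_coe, LinearEquiv.map_eq_zero_iff,
    LinearMap.comp_apply, hp0]
  constructor
  · rintro ⟨y, hy⟩
    exact ⟨y.hom, congrArg ModuleCat.Hom.hom hy⟩
  · rintro ⟨y, hy⟩
    exact ⟨ModuleCat.ofHom y, ModuleCat.hom_ext hy⟩

/-- An exact complex of projective modules augmented by `X` is a projective resolution of `X`. -/
noncomputable def ChainComplex.toProjectiveResolution {R : Type} [CommRing R] {X : ModuleCat.{0} R}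
    (C : ChainComplex (ModuleCat.{0} R) ℕ) (hC : ∀ n, Projective (C.X n)) (ε : C.X 0 ⟶ X)
    (surj : Function.Surjective ε) (exact_at_zero : Function.Exact (C.d 1 0) ε)
    (exact_at : ∀ n, Function.Exact (C.d (n + 2) (n + 1)) (C.d (n + 1) n)) :
    ProjectiveResolution X where
  complex := C
  projective := hC
  π := (ChainComplex.toSingle₀Equiv _ _).symm ⟨ε, by
    ext x
    exact exact_at_zero.apply_apply_eq_zero x⟩
  quasiIso := ⟨fun n => by
    cases n with
    | zero =>
      rw [ChainComplex.quasiIsoAt₀_iff, ShortComplex.quasiIso_iff_of_zeros' _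
        (C.shape _ _ (by simp)) rfl rfl]
      have hz : C.d 1 0 ≫ ε = 0 := by
        ext x
        exact exact_at_zero.apply_apply_eq_zero x
      refine (ShortComplex.exact_and_epi_g_iff_of_iso (S₂ := ShortComplex.mk (C.d 1 0) ε hz) ?_).2
        ⟨ModuleCat.shortComplex_exact _ exact_at_zero, (ModuleCat.epi_iff_surjective _).2 surj⟩
      refine ShortComplex.isoMk (Iso.refl _) (Iso.refl _) (Iso.refl _) ?_ ?_
      · exact (Category.id_comp _).trans (Category.comp_id _).symm
      · refine (Category.id_comp _).trans (Eq.trans ?_ (Category.comp_id _).symm)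
        exact (ChainComplex.toSingle₀Equiv_symm_apply_f_zero ε hz).symm
    | succ n =>
      rw [quasiIsoAt_iff_exactAt' _ _ (ChainComplex.exactAt_succ_single_obj _ _),
        HomologicalComplex.exactAt_iff' _ (n + 1 + 1) (n + 1) n (by simp) (by simp)]
      exact ModuleCat.shortComplex_exact _ (exact_at n)⟩

/-- Positive-degree Ext modules as quotients of the module of cocycles, computed with an exact
sequence of projective modules. -/
lemma exists_cocycles_to_ext_of_exact {R : Type} [CommRing R] {X : ModuleCat.{0} R}
    (F : ℕ → ModuleCat.{0} R) (hF : ∀ n, Projective (F n)) (d : ∀ n, F (n + 1) ⟶ F n)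
    (ε : F 0 ⟶ X) (surj : Function.Surjective ε) (exact_at_zero : Function.Exact (d 0) ε)
    (exact_at : ∀ n, Function.Exact (d (n + 1)) (d n)) (Y : ModuleCat.{0} R) (n : ℕ) :
    ∃ p : LinearMap.ker (LinearMap.lcomp R Y (d (n + 1)).hom) →ₗ[R]
        ((Ext R (ModuleCat R) (n + 1)).obj (Opposite.op X)).obj Y,
      Function.Surjective p ∧
        ∀ x, p x = 0 ↔ ∃ y : F n →ₗ[R] Y, y ∘ₗ (d n).hom = x := by
  let C : ChainComplex (ModuleCat.{0} R) ℕ := ChainComplex.of F d fun n => by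
    ext x
    exact (exact_at n).apply_apply_eq_zero x
  have hd : ∀ n, C.d (n + 1) n = d n := ChainComplex.of_d F d
  have h := (C.toProjectiveResolution hF ε surj (by rw [hd 0]; exact exact_at_zero)
    (fun n => by rw [hd n, hd (n + 1)]; exact exact_at n)).exists_cocycles_to_ext Y n
  change ∃ p : LinearMap.ker (LinearMap.lcomp R Y (C.d (n + 1 + 1) (n + 1)).hom) →ₗ[R] _,
    Function.Surjective p ∧
      ∀ x, p x = 0 ↔ ∃ y : F n →ₗ[R] Y, y ∘ₗ (C.d (n + 1) n).hom = x at h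
  rw [hd n, hd (n + 1)] at h
  exact h

/-- The terms of the sequence obtained from a complex `Q` and modules `A`, `B` by placing `B`
in degree `0`, `A` in degree `1` and shifting `Q` by two degrees. -/
def spliceObj {R : Type} [CommRing R] (Q : ChainComplex (ModuleCat.{0} R) ℕ)
    (A B : ModuleCat.{0} R) : ℕ → ModuleCat.{0} R
  | 0 => B
  | 1 => A
  | n + 2 => Q.X n

/-- The differentials of the sequence with terms `spliceObj Q A B`. -/
def spliceD {R : Type} [CommRing R] (Q : ChainComplex (ModuleCat.{0} R) ℕ)
    {A B : ModuleCat.{0} R} (i : Q.X 0 ⟶ A) (δ : A ⟶ B) :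
    ∀ n, spliceObj Q A B (n + 1) ⟶ spliceObj Q A B n
  | 0 => δ
  | 1 => i
  | n + 2 => Q.d (n + 1) n

/-- For a map `δ : A → B` of projective modules, the first and second Ext modules of the cokernel
of `δ` in terms of linear maps out of `A` and out of the kernel of `δ`. -/
lemma exists_ext_one_ext_two_of_range_quotient {R : Type} [CommRing R] {A B : Type}
    [AddCommGroup A] [Module R A] [AddCommGroup B] [Module R B]
    [Module.Projective R A] [Module.Projective R B] (δ : A →ₗ[R] B)
    (N : Type) [AddCommGroup N] [Module R N] :
    (∃ p : LinearMap.ker (LinearMap.lcomp R N (LinearMap.ker δ).subtype) →ₗ[R]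
        extMod R 1 (B ⧸ LinearMap.range δ) N,
      Function.Surjective p ∧ ∀ x, p x = 0 ↔ ∃ y : B →ₗ[R] N, y ∘ₗ δ = x) ∧
    ∃ q : (LinearMap.ker δ →ₗ[R] N) →ₗ[R] extMod R 2 (B ⧸ LinearMap.range δ) N,
      ∀ x, q x = 0 ↔ ∃ y : A →ₗ[R] N, y ∘ₗ (LinearMap.ker δ).subtype = x := by
  let Q := ProjectiveResolution.of (ModuleCat.of R (LinearMap.ker δ))
  let π : Q.complex.X 0 →ₗ[R] LinearMap.ker δ := (Q.π.f 0).hom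
  have hπ : Function.Surjective π := (ModuleCat.epi_iff_surjective (Q.π.f 0)).1 inferInstance
  have hQ : Function.Exact (Q.complex.d 1 0).hom π :=
    (ShortComplex.ShortExact.moduleCat_exact_iff_function_exact
      (ShortComplex.mk _ _ Q.complex_d_comp_π_f_zero)).1
        (ShortComplex.exact_of_g_is_cokernel _ Q.isColimitCokernelCofork)
  let i : Q.complex.X 0 →ₗ[R] A := (LinearMap.ker δ).subtype ∘ₗ π
  let F := spliceObj Q.complex (ModuleCat.of R A) (ModuleCat.of R B)
  let d : ∀ n, F (n + 1) ⟶ F n := spliceD Q.complex (ModuleCat.ofHom i) (ModuleCat.ofHom δ)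
  have hF : ∀ n, Projective (F n)
    | 0 => (IsProjective.iff_projective B).1 inferInstance
    | 1 => (IsProjective.iff_projective A).1 inferInstance
    | n + 2 => Q.projective n
  have h0 : Function.Exact δ (LinearMap.range δ).mkQ := fun x => by simp
  have hi : Function.Exact i δ := fun x => by
    constructor
    · intro hx
      obtain ⟨y, hy⟩ := hπ ⟨x, hx⟩
      exact ⟨y, congrArg Subtype.val hy⟩
    · rintro ⟨y, rfl⟩
      exact (π y).2
  have hd : ∀ n, Function.Exact (d (n + 1)) (d n)
    | 0 => hi
    | 1 => fun x => by
      refine Iff.trans ?_ (hQ x)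
      exact Subtype.val_injective.eq_iff (a := π x) (b := 0)
    | n + 2 => (ShortComplex.ShortExact.moduleCat_exact_iff_function_exact _).1 (Q.exact_succ n)
  have ext := exists_cocycles_to_ext_of_exact (X := ModuleCat.of R (B ⧸ LinearMap.range δ)) F hF d
    (ModuleCat.ofHom (LinearMap.range δ).mkQ) (Submodule.mkQ_surjective _) h0 hd (ModuleCat.of R N)
  obtain ⟨p, hp, hp0⟩ := ext 0
  obtain ⟨q, -, hq0⟩ := ext 1
  have hcancel : ∀ f g : LinearMap.ker δ →ₗ[R] N, f ∘ₗ π = g ∘ₗ π → f = g := fun f g h =>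
    LinearMap.ext fun x => by
      obtain ⟨y, rfl⟩ := hπ x
      exact LinearMap.congr_fun h y
  constructor
  · have hker : LinearMap.ker (LinearMap.lcomp R N (LinearMap.ker δ).subtype) =
        LinearMap.ker (LinearMap.lcomp R N i) := by
      ext f
      constructor
      · intro hf
        exact congrArg (· ∘ₗ π) hf
      · intro hf
        exact hcancel _ _ (hf.trans (LinearMap.zero_comp π).symm)
    let c := LinearEquiv.ofEq _ _ hker
    exact ⟨p ∘ₗ c.toLinearMap, hp.comp c.surjective, fun x => hp0 (c x)⟩
  · let c : (LinearMap.ker δ →ₗ[R] N) →ₗ[R]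
        LinearMap.ker (LinearMap.lcomp R N (Q.complex.d 1 0).hom) :=
      (LinearMap.lcomp R N π).codRestrict _ fun f => by
        ext x
        exact (congrArg f (hQ.apply_apply_eq_zero x)).trans (map_zero f)
    refine ⟨q ∘ₗ c, fun x => (hq0 (c x)).trans (exists_congr fun y => ?_)⟩
    exact ⟨fun h => hcancel _ _ h, fun h => congrArg (· ∘ₗ π) h⟩

/-- `Ext^(n+1)(M, R)` as a quotient of the cocycles of the dual of a resolution of `M`. -/
lemma FiniteFreeResolution.exists_cocycles_to_ext {R : Type} [CommRing R] {M : Type}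
    [AddCommGroup M] [Module R M] (res : FiniteFreeResolution R M) (n : ℕ) :
    ∃ p : LinearMap.ker (res.d (n + 1)).dualMap →ₗ[R] extMod R (n + 1) M R,
      Function.Surjective p ∧ ∀ x, p x = 0 ↔ ∃ y, (res.d n).dualMap y = x :=
  exists_cocycles_to_ext_of_exact (X := ModuleCat.of R M) (fun n => ModuleCat.of R (res.F n))
    (fun n => by
      have := res.free n
      exact (IsProjective.iff_projective (res.F n)).1 inferInstance)
    (fun n => ModuleCat.ofHom (res.d n)) (ModuleCat.ofHom res.ε) res.surj res.exact_at_zero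
    res.exact_at (ModuleCat.of R R) n

/-- The complex `X ⊗ Q`. -/
noncomputable abbrev tensorComplex {R : Type} [CommRing R] (Q : ChainComplex (ModuleCat.{0} R) ℕ)
    (X : Type) [AddCommGroup X] [Module R X] : ChainComplex (ModuleCat.{0} R) ℕ :=
  (((MonoidalCategory.tensoringLeft (ModuleCat.{0} R)).obj
    (ModuleCat.of R X)).mapHomologicalComplex (ComplexShape.down ℕ)).obj Q

/-- The map of complexes `X ⊗ Q → Y ⊗ Q` induced by a linear map `X → Y`. -/
noncomputable abbrev tensorComplexMap {R : Type} [CommRing R]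
    (Q : ChainComplex (ModuleCat.{0} R) ℕ) {X Y : Type} [AddCommGroup X] [Module R X]
    [AddCommGroup Y] [Module R Y] (f : X →ₗ[R] Y) : tensorComplex Q X ⟶ tensorComplex Q Y :=
  (NatTrans.mapHomologicalComplex
    ((MonoidalCategory.tensoringLeft (ModuleCat.{0} R)).map (ModuleCat.ofHom f))
    (ComplexShape.down ℕ)).app Q

/-- The short complex `X' ⊗ Q → F ⊗ Q → X ⊗ Q`. -/
noncomputable def tensorShortComplex {R : Type} [CommRing R]
    (Q : ChainComplex (ModuleCat.{0} R) ℕ) {X' F X : Type} [AddCommGroup X'] [Module R X']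
    [AddCommGroup F] [Module R F] [AddCommGroup X] [Module R X]
    (f : X' →ₗ[R] F) (g : F →ₗ[R] X) (hfg : Function.Exact f g) :
    ShortComplex (ChainComplex (ModuleCat.{0} R) ℕ) where
  X₁ := tensorComplex Q X'
  X₂ := tensorComplex Q F
  X₃ := tensorComplex Q X
  f := tensorComplexMap Q f
  g := tensorComplexMap Q g
  zero := by
    refine HomologicalComplex.hom_ext _ _ fun i => ModuleCat.hom_ext ?_
    change g.rTensor (Q.X i) ∘ₗ f.rTensor (Q.X i) = 0
    rw [← LinearMap.rTensor_comp, hfg.linearMap_comp_eq_zero, LinearMap.rTensor_zero]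

lemma tensorShortComplex_shortExact {R : Type} [CommRing R]
    (Q : ChainComplex (ModuleCat.{0} R) ℕ) [∀ i, Projective (Q.X i)]
    {X' F X : Type} [AddCommGroup X'] [Module R X']
    [AddCommGroup F] [Module R F] [AddCommGroup X] [Module R X]
    (f : X' →ₗ[R] F) (g : F →ₗ[R] X) (hfg : Function.Exact f g)
    (hf : Function.Injective f) (hg : Function.Surjective g) :
    (tensorShortComplex Q f g hfg).ShortExact :=
  HomologicalComplex.shortExact_of_degreewise_shortExact _ fun i => by
    have : Module.Projective R (Q.X i) := (IsProjective.iff_projective (Q.X i)).2 inferInstance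
    exact ModuleCat.shortComplex_shortExact _ (rTensor_exact (Q.X i) hfg hg)
      (Module.Flat.rTensor_preserves_injective_linearMap f hf)
      (LinearMap.rTensor_surjective (Q.X i) hg)

lemma isZero_homology_tensorComplex_succ {R : Type} [CommRing R] {Y : ModuleCat.{0} R}
    (Q : ProjectiveResolution Y) (F : Type) [AddCommGroup F] [Module R F] [Module.Flat R F]
    (n : ℕ) : Limits.IsZero ((tensorComplex Q.complex F).homology (n + 1)) := by
  rw [← HomologicalComplex.exactAt_iff_isZero_homology,
    HomologicalComplex.exactAt_iff' _ (n + 1 + 1) (n + 1) n (by simp) (by simp)]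
  exact ModuleCat.shortComplex_exact _ (Module.Flat.lTensor_exact F
    ((ShortComplex.ShortExact.moduleCat_exact_iff_function_exact _).1 (Q.exact_succ n)))

/-- The augmentation map of a projective resolution of `N`. -/
noncomputable def CategoryTheory.ProjectiveResolution.augmentation {R : Type} [CommRing R]
    {N : Type} [AddCommGroup N] [Module R N] (Q : ProjectiveResolution (ModuleCat.of R N)) :
    Q.complex.X 0 →ₗ[R] N :=
  (Q.π.f 0).hom

lemma CategoryTheory.ProjectiveResolution.augmentation_surjective {R : Type} [CommRing R]
    {N : Type} [AddCommGroup N] [Module R N] (Q : ProjectiveResolution (ModuleCat.of R N)) :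
    Function.Surjective Q.augmentation :=
  (ModuleCat.epi_iff_surjective (Q.π.f 0)).1 inferInstance

lemma CategoryTheory.ProjectiveResolution.exact_augmentation {R : Type} [CommRing R]
    {N : Type} [AddCommGroup N] [Module R N] (Q : ProjectiveResolution (ModuleCat.of R N)) :
    Function.Exact (Q.complex.d 1 0).hom Q.augmentation :=
  (ShortComplex.ShortExact.moduleCat_exact_iff_function_exact
    (ShortComplex.mk _ _ Q.complex_d_comp_π_f_zero)).1
      (ShortComplex.exact_of_g_is_cokernel _ Q.isColimitCokernelCofork)

/-- The map `X ⊗ Q_0 → X ⊗ N` induced by the augmentation of a projective resolution `Q` of `N`. -/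
noncomputable def tensorAugmentation {R : Type} [CommRing R] {N : Type} [AddCommGroup N]
    [Module R N] (Q : ProjectiveResolution (ModuleCat.of R N)) (X : Type) [AddCommGroup X]
    [Module R X] : (tensorComplex Q.complex X).X 0 ⟶ ModuleCat.of R (TensorProduct R X N) :=
  ModuleCat.ofHom (Q.augmentation.lTensor X)

lemma tensorComplex_d_comp_tensorAugmentation {R : Type} [CommRing R] {N : Type} [AddCommGroup N]
    [Module R N] (Q : ProjectiveResolution (ModuleCat.of R N)) (X : Type) [AddCommGroup X]
    [Module R X] : (tensorComplex Q.complex X).d 1 0 ≫ tensorAugmentation Q X = 0 := by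
  refine ModuleCat.hom_ext ?_
  change Q.augmentation.lTensor X ∘ₗ LinearMap.lTensor X (Q.complex.d 1 0).hom = 0
  rw [← LinearMap.lTensor_comp, Q.exact_augmentation.linearMap_comp_eq_zero,
    LinearMap.lTensor_zero]

/-- The natural map `H_0(X ⊗ Q) → X ⊗ N` for a projective resolution `Q` of `N`. -/
noncomputable def tensorComplexHomologyZero {R : Type} [CommRing R] {N : Type} [AddCommGroup N]
    [Module R N] (Q : ProjectiveResolution (ModuleCat.of R N)) (X : Type) [AddCommGroup X]
    [Module R X] :
    (tensorComplex Q.complex X).homology 0 ⟶ ModuleCat.of R (TensorProduct R X N) :=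
  (tensorComplex Q.complex X).homologyι 0 ≫ (tensorComplex Q.complex X).descOpcycles
    (tensorAugmentation Q X) 1 (by simp) (tensorComplex_d_comp_tensorAugmentation Q X)

lemma tensorComplexHomologyZero_naturality {R : Type} [CommRing R] {N : Type} [AddCommGroup N]
    [Module R N] (Q : ProjectiveResolution (ModuleCat.of R N)) {X Y : Type} [AddCommGroup X]
    [Module R X] [AddCommGroup Y] [Module R Y] (f : X →ₗ[R] Y) :
    HomologicalComplex.homologyMap (tensorComplexMap Q.complex f) 0 ≫
        tensorComplexHomologyZero Q Y =
      tensorComplexHomologyZero Q X ≫ ModuleCat.ofHom (f.rTensor N) := by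
  rw [tensorComplexHomologyZero, tensorComplexHomologyZero, Category.assoc,
    HomologicalComplex.homologyι_naturality_assoc]
  congr 1
  rw [← cancel_epi ((tensorComplex Q.complex X).pOpcycles 0),
    HomologicalComplex.p_opcyclesMap_assoc, HomologicalComplex.p_descOpcycles,
    HomologicalComplex.p_descOpcycles_assoc]
  refine ModuleCat.hom_ext ?_
  change Q.augmentation.lTensor Y ∘ₗ LinearMap.rTensor (Q.complex.X 0) f =
    LinearMap.rTensor N f ∘ₗ Q.augmentation.lTensor X
  exact TensorProduct.ext' fun _ _ => rfl

instance {R : Type} [CommRing R] {N : Type} [AddCommGroup N]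
    [Module R N] (Q : ProjectiveResolution (ModuleCat.of R N)) (X : Type) [AddCommGroup X]
    [Module R X] : IsIso (tensorComplexHomologyZero Q X) := by
  have : IsIso ((tensorComplex Q.complex X).descOpcycles (tensorAugmentation Q X) 1 (by simp)
      (tensorComplex_d_comp_tensorAugmentation Q X)) :=
    (ChainComplex.isIso_descOpcycles_iff _ _ _).2
      ⟨ModuleCat.shortComplex_exact _
        (lTensor_exact X Q.exact_augmentation Q.augmentation_surjective),
      (ModuleCat.epi_iff_surjective _).2 (LinearMap.lTensor_surjective X Q.augmentation_surjective)⟩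
  rw [tensorComplexHomologyZero]
  infer_instance

lemma tensorComplexHomologyZero_bijective {R : Type} [CommRing R] {N : Type} [AddCommGroup N]
    [Module R N] (Q : ProjectiveResolution (ModuleCat.of R N)) (X : Type) [AddCommGroup X]
    [Module R X] : Function.Bijective (tensorComplexHomologyZero Q X) :=
  ConcreteCategory.bijective_of_isIso _

/-- Dimension shifting for the homology of `X ⊗ Q`, in high degrees. -/
lemma nonempty_homology_tensorComplex_equiv {R : Type} [CommRing R] {N : Type} [AddCommGroup N]
    [Module R N] (Q : ProjectiveResolution (ModuleCat.of R N)) {X' F X : Type}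
    [AddCommGroup X'] [Module R X'] [AddCommGroup F] [Module R F] [AddCommGroup X] [Module R X]
    [Module.Flat R F] (f : X' →ₗ[R] F) (g : F →ₗ[R] X) (hfg : Function.Exact f g)
    (hf : Function.Injective f) (hg : Function.Surjective g) (n : ℕ) :
    Nonempty ((tensorComplex Q.complex X).homology (n + 2) ≃ₗ[R]
      (tensorComplex Q.complex X').homology (n + 1)) :=
  ⟨((tensorShortComplex_shortExact Q.complex f g hfg hf hg).δIso (n + 2) (n + 1) rfl
    (isZero_homology_tensorComplex_succ Q F (n + 1))
    (isZero_homology_tensorComplex_succ Q F n)).toLinearEquiv⟩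

/-- Dimension shifting for the homology of `X ⊗ Q`, in degree one. -/
lemma exists_homology_one_tensorComplex_exact {R : Type} [CommRing R] {N : Type} [AddCommGroup N]
    [Module R N] (Q : ProjectiveResolution (ModuleCat.of R N)) {X' F X : Type}
    [AddCommGroup X'] [Module R X'] [AddCommGroup F] [Module R F] [AddCommGroup X] [Module R X]
    [Module.Flat R F] (f : X' →ₗ[R] F) (g : F →ₗ[R] X) (hfg : Function.Exact f g)
    (hf : Function.Injective f) (hg : Function.Surjective g) :
    ∃ τ : (tensorComplex Q.complex X).homology 1 →ₗ[R] TensorProduct R X' N,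
      Function.Injective τ ∧ Function.Exact τ (f.rTensor N) := by
  have hS := tensorShortComplex_shortExact Q.complex f g hfg hf hg
  let δ : (tensorComplex Q.complex X).homology 1 →ₗ[R] (tensorComplex Q.complex X').homology 0 :=
    (hS.δ 1 0 rfl).hom
  have hδ : Function.Injective δ :=
    (ModuleCat.mono_iff_injective _).1 (hS.mono_δ 1 0 rfl (isZero_homology_tensorComplex_succ Q F 0))
  have hδ' : Function.Exact δ
      (HomologicalComplex.homologyMap (tensorComplexMap Q.complex f) 0) :=
    (ShortComplex.ShortExact.moduleCat_exact_iff_function_exact _).1 (hS.homology_exact₁ 1 0 rfl)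
  refine ⟨(tensorComplexHomologyZero Q X').hom ∘ₗ δ,
    (tensorComplexHomologyZero_bijective Q X').1.comp hδ, fun x => ?_⟩
  obtain ⟨z, rfl⟩ := (tensorComplexHomologyZero_bijective Q X').2 x
  have hnat : f.rTensor N (tensorComplexHomologyZero Q X' z) = tensorComplexHomologyZero Q F
      (HomologicalComplex.homologyMap (tensorComplexMap Q.complex f) 0 z) :=
    (ConcreteCategory.congr_hom (tensorComplexHomologyZero_naturality Q f) z).symm
  rw [hnat, ← map_zero (tensorComplexHomologyZero Q F).hom]
  refine ((tensorComplexHomologyZero_bijective Q F).1.eq_iff).trans ((hδ' z).trans ?_)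
  exact exists_congr fun y => ((tensorComplexHomologyZero_bijective Q X').1.eq_iff).symm

/-- `Tor_n(M, N)` is the homology of `M ⊗ Q` for a projective resolution `Q` of `N`. -/
noncomputable def torModEquiv {R : Type} [CommRing R] {N : Type} [AddCommGroup N] [Module R N]
    (Q : ProjectiveResolution (ModuleCat.of R N)) (M : Type) [AddCommGroup M] [Module R M] (n : ℕ) :
    torMod R n M N ≃ₗ[R] (tensorComplex Q.complex M).homology n :=
  (Q.isoLeftDerivedObj ((MonoidalCategory.tensoringLeft (ModuleCat.{0} R)).obj
    (ModuleCat.of R M)) n).toLinearEquiv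

lemma FiniteFreeResolution.nonempty_homology_tensorComplex_range_equiv {R : Type} [CommRing R]
    {M N : Type} [AddCommGroup M] [Module R M] [AddCommGroup N] [Module R N]
    (res : FiniteFreeResolution R M) (Q : ProjectiveResolution (ModuleCat.of R N)) (m k : ℕ) :
    Nonempty ((tensorComplex Q.complex M).homology (m + k + 2) ≃ₗ[R]
      (tensorComplex Q.complex (LinearMap.range (res.d m))).homology (k + 1)) := by
  induction m generalizing k with
  | zero =>
    have := res.free 0
    rw [zero_add]
    exact nonempty_homology_tensorComplex_equiv Q (LinearMap.range (res.d 0)).subtype res.ε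
      (fun x => (res.exact_at_zero x).trans (by simp)) Subtype.val_injective res.surj k
  | succ m ih =>
    have := res.free (m + 1)
    obtain ⟨e⟩ := ih (k + 1)
    obtain ⟨e'⟩ := nonempty_homology_tensorComplex_equiv Q
      (LinearMap.range (res.d (m + 1))).subtype (res.d m).rangeRestrict
      (fun x => by simpa [Subtype.ext_iff] using res.exact_at m x) Subtype.val_injective
      (res.d m).surjective_rangeRestrict k
    rw [show m + 1 + k + 2 = m + (k + 1) + 2 by omega]
    exact ⟨e.trans e'⟩

/-- `Tor_(n+1)(M, N)` is the kernel of `Ω^(n+1) M ⊗ N → F_n ⊗ N`. -/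
lemma FiniteFreeResolution.exists_torMod_exact {R : Type} [CommRing R]
    {M : Type} [AddCommGroup M] [Module R M] (res : FiniteFreeResolution R M)
    (N : Type) [AddCommGroup N] [Module R N] (n : ℕ) :
    ∃ τ : torMod R (n + 1) M N →ₗ[R] TensorProduct R (LinearMap.range (res.d n)) N,
      Function.Injective τ ∧ Function.Exact τ ((LinearMap.range (res.d n)).subtype.rTensor N) := by
  let Q := ProjectiveResolution.of (ModuleCat.of R N)
  suffices h : ∃ τ : (tensorComplex Q.complex M).homology (n + 1) →ₗ[R]
      TensorProduct R (LinearMap.range (res.d n)) N, Function.Injective τ ∧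
        Function.Exact τ ((LinearMap.range (res.d n)).subtype.rTensor N) by
    obtain ⟨τ, hτ, hex⟩ := h
    let e := torModEquiv Q M (n + 1)
    exact ⟨τ ∘ₗ e.toLinearMap, hτ.comp e.injective, LinearEquiv.precomp_exact_iff_exact.2 hex⟩
  cases n with
  | zero =>
    have := res.free 0
    exact exists_homology_one_tensorComplex_exact Q (LinearMap.range (res.d 0)).subtype res.ε
      (fun x => (res.exact_at_zero x).trans (by simp)) Subtype.val_injective res.surj
  | succ m =>
    have := res.free (m + 1)
    obtain ⟨e⟩ := res.nonempty_homology_tensorComplex_range_equiv Q m 0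
    obtain ⟨τ, hτ, hex⟩ := exists_homology_one_tensorComplex_exact Q
      (LinearMap.range (res.d (m + 1))).subtype (res.d m).rangeRestrict
      (fun x => by simpa [Subtype.ext_iff] using res.exact_at m x) Subtype.val_injective
      (res.d m).surjective_rangeRestrict
    exact ⟨τ ∘ₗ e.toLinearMap, hτ.comp e.injective, LinearEquiv.precomp_exact_iff_exact.2 hex⟩

/-- The evaluation map `F ⊗ N → Hom(F^*, N)`. -/
noncomputable def tensorDualHom (R : Type) [CommRing R] (F N : Type) [AddCommGroup F] [Module R F]
    [AddCommGroup N] [Module R N] : TensorProduct R F N →ₗ[R] (Module.Dual R F →ₗ[R] N) :=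
  dualTensorHom R (Module.Dual R F) N ∘ₗ (Module.Dual.eval R F).rTensor N

lemma tensorDualHom_bijective (R : Type) [CommRing R] (F N : Type) [AddCommGroup F] [Module R F]
    [AddCommGroup N] [Module R N] [Module.Free R F] [Module.Finite R F] :
    Function.Bijective (tensorDualHom R F N) :=
  (dualTensorHomEquiv (R := R) (M := Module.Dual R F) (N := N)).bijective.comp
    ((Module.evalEquiv R F).rTensor N).bijective

lemma tensorDualHom_rTensor {R : Type} [CommRing R] {F G : Type} (N : Type) [AddCommGroup F]
    [Module R F] [AddCommGroup G] [Module R G] [AddCommGroup N] [Module R N] (f : F →ₗ[R] G)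
    (x : TensorProduct R F N) :
    tensorDualHom R G N (f.rTensor N x) = tensorDualHom R F N x ∘ₗ f.dualMap := by
  refine LinearMap.congr_fun (f := tensorDualHom R G N ∘ₗ f.rTensor N)
    (g := LinearMap.lcomp R N f.dualMap ∘ₗ tensorDualHom R F N) (TensorProduct.ext' fun _ _ => ?_) x
  rfl

/-- Linear maps factor through injective maps containing their range. -/
lemma LinearMap.exists_comp_eq_of_injective {R A B C : Type} [CommRing R] [AddCommGroup A]
    [Module R A] [AddCommGroup B] [Module R B] [AddCommGroup C] [Module R C] (i : B →ₗ[R] C)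
    (hi : Function.Injective i) (f : A →ₗ[R] C) (hf : ∀ x, ∃ y, i y = f x) :
    ∃ g : A →ₗ[R] B, ∀ x, i (g x) = f x := by
  refine ⟨(LinearEquiv.ofInjective i hi).symm.toLinearMap ∘ₗ f.codRestrict (LinearMap.range i) hf,
    fun x => ?_⟩
  exact congrArg Subtype.val ((LinearEquiv.ofInjective i hi).apply_symm_apply _)

/-- Linear maps factor through surjective maps whose kernel they kill. -/
lemma LinearMap.exists_comp_eq_of_surjective {R A B C : Type} [CommRing R] [AddCommGroup A]
    [Module R A] [AddCommGroup B] [Module R B] [AddCommGroup C] [Module R C] (p : A →ₗ[R] B)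
    (hp : Function.Surjective p) (f : A →ₗ[R] C) (hf : ∀ x, p x = 0 → f x = 0) :
    ∃ g : B →ₗ[R] C, ∀ x, g (p x) = f x := by
  refine ⟨(LinearMap.ker p).liftQ f hf ∘ₗ (p.quotKerEquivOfSurjective hp).symm.toLinearMap,
    fun x => ?_⟩
  have : (p.quotKerEquivOfSurjective hp).symm (p x) = (LinearMap.ker p).mkQ x :=
    (LinearEquiv.symm_apply_eq _).2 rfl
  rw [LinearMap.comp_apply, LinearEquiv.coe_coe, this]
  rfl

/-- `Tor_(n+1)(M, N)` as a quotient of cocycles in `Hom(F_•^*, N)` for a finite free resolution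
`F_•` of `M`. -/
lemma FiniteFreeResolution.exists_cocycles_to_torMod {R : Type} [CommRing R]
    {M : Type} [AddCommGroup M] [Module R M] (res : FiniteFreeResolution R M)
    (N : Type) [AddCommGroup N] [Module R N] (n : ℕ) :
    ∃ t : LinearMap.ker (LinearMap.lcomp R N (res.d n).dualMap) →ₗ[R] torMod R (n + 1) M N,
      Function.Surjective t ∧
        ∀ x, t x = 0 ↔ ∃ y : Module.Dual R (res.F (n + 2)) →ₗ[R] N,
          y ∘ₗ (res.d (n + 1)).dualMap = x := by
  obtain ⟨τ, hτ, hex⟩ := res.exists_torMod_exact N n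
  have := res.free
  have := res.finite
  have hbij (k : ℕ) := tensorDualHom_bijective R (res.F k) N
  let e := LinearEquiv.ofBijective _ (hbij (n + 1))
  have he (x : TensorProduct R (res.F (n + 1)) N) : e x = tensorDualHom R (res.F (n + 1)) N x := rfl
  let ρ := (res.d n).rangeRestrict.rTensor N
  have hρ : Function.Surjective ρ :=
    LinearMap.rTensor_surjective N (res.d n).surjective_rangeRestrict
  have hρ0 : Function.Exact ((res.d (n + 1)).rTensor N) ρ :=
    rTensor_exact N (fun x => by simpa [Subtype.ext_iff] using res.exact_at n x)
      (res.d n).surjective_rangeRestrict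
  have hcomp (x : TensorProduct R (res.F (n + 1)) N) :
      (LinearMap.range (res.d n)).subtype.rTensor N (ρ x) = (res.d n).rTensor N x :=
    (LinearMap.rTensor_comp_apply N _ _ x).symm
  have hcocycle (x : TensorProduct R (res.F (n + 1)) N) :
      (res.d n).rTensor N x = 0 ↔ e x ∘ₗ (res.d n).dualMap = 0 := by
    rw [he, ← tensorDualHom_rTensor, map_eq_zero_iff _ (hbij n).1]
  obtain ⟨t, ht⟩ := LinearMap.exists_comp_eq_of_injective τ hτ
    (ρ ∘ₗ e.symm.toLinearMap ∘ₗ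
      (LinearMap.ker (LinearMap.lcomp R N (res.d n).dualMap)).subtype) (fun x => by
        refine (hex _).1 ((hcomp _).trans ((hcocycle _).2 ?_))
        rw [LinearMap.comp_apply, LinearEquiv.coe_coe, LinearEquiv.apply_symm_apply]
        exact x.2)
  refine ⟨t, fun z => ?_, fun x => ?_⟩
  · obtain ⟨w, hw⟩ := hρ (τ z)
    have hw0 : (res.d n).rTensor N w = 0 := by
      rw [← hcomp, hw]
      exact hex.apply_apply_eq_zero z
    refine ⟨⟨e w, (hcocycle w).1 hw0⟩, hτ ((ht _).trans ?_)⟩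
    rw [← hw]
    exact congrArg ρ (e.symm_apply_apply w)
  · rw [← map_eq_zero_iff τ hτ, ht]
    refine (hρ0 (e.symm x)).trans ⟨?_, ?_⟩
    · rintro ⟨y, hy⟩
      refine ⟨tensorDualHom R _ N y, ?_⟩
      rw [← tensorDualHom_rTensor, hy]
      exact e.apply_symm_apply x
    · rintro ⟨y, hy⟩
      obtain ⟨w, rfl⟩ := (hbij (n + 2)).2 y
      refine ⟨w, (LinearEquiv.eq_symm_apply e).2 ?_⟩
      rw [he, tensorDualHom_rTensor, hy]

/-- For every `n ≥ 1` there is an exact sequence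
`0 → Ext^1_R(Tr Ω^n M, N) → Tor_n^R(M, N) → Hom_R(Ext^n_R(M, R), N) → Ext^2_R(Tr Ω^n M, N)`. -/
theorem exists_exact_sequence_ext_tor_hom_ext
    (R : Type) [CommRing R] [IsNoetherianRing R] [IsLocalRing R]
    (M N : Type) [AddCommGroup M] [Module R M] [AddCommGroup N] [Module R N]
    [Module.Finite R M] [Module.Finite R N]
    (res : FiniteFreeResolution R M) (n : ℕ) (hn : 1 ≤ n) :
    ∃ (α : extMod R 1 (res.trSyzygy n) N →ₗ[R] torMod R n M N)
      (β : torMod R n M N →ₗ[R] (extMod R n M R →ₗ[R] N))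
      (γ : (extMod R n M R →ₗ[R] N) →ₗ[R] extMod R 2 (res.trSyzygy n) N),
      Function.Injective α ∧ Function.Exact α β ∧ Function.Exact β γ := by
  obtain ⟨m, rfl⟩ : ∃ m, n = m + 1 := ⟨n - 1, by omega⟩
  have := res.free
  have := res.finite
  obtain ⟨⟨p, hp, hp0⟩, q, hq0⟩ :=
    exists_ext_one_ext_two_of_range_quotient (res.d (m + 1)).dualMap N
  obtain ⟨t, ht, ht0⟩ := res.exists_cocycles_to_torMod N m
  obtain ⟨r, hr, hr0⟩ := res.exists_cocycles_to_ext m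
  have hdd : ∀ y, (res.d (m + 1)).dualMap ((res.d m).dualMap y) = 0 := fun y =>
    LinearMap.ext fun x =>
      (congrArg y ((res.exact_at m).apply_apply_eq_zero x)).trans (map_zero y)
  -- Restriction along the projection of cocycles onto `Ext^n(M, R)`.
  have hr_inj : Function.Injective (LinearMap.lcomp R N r) := fun f g h =>
    LinearMap.ext fun x => by
      obtain ⟨y, rfl⟩ := hr x
      exact LinearMap.congr_fun h y
  have hle : LinearMap.ker (LinearMap.lcomp R N (LinearMap.ker (res.d (m + 1)).dualMap).subtype) ≤
      LinearMap.ker (LinearMap.lcomp R N (res.d m).dualMap) := fun f hf =>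
    LinearMap.ext fun y => LinearMap.congr_fun hf ⟨_, hdd y⟩
  obtain ⟨α, hα⟩ := LinearMap.exists_comp_eq_of_surjective p hp (t ∘ₗ Submodule.inclusion hle)
    fun x hx => (ht0 _).2 ((hp0 x).1 hx)
  obtain ⟨b, hb⟩ := LinearMap.exists_comp_eq_of_injective (LinearMap.lcomp R N r) hr_inj
    (LinearMap.lcomp R N (LinearMap.ker (res.d (m + 1)).dualMap).subtype ∘ₗ
      (LinearMap.ker (LinearMap.lcomp R N (res.d m).dualMap)).subtype) fun g => by
    obtain ⟨c, hc⟩ := LinearMap.exists_comp_eq_of_surjective r hr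
      (g.1 ∘ₗ (LinearMap.ker (res.d (m + 1)).dualMap).subtype) fun x (hx : r x = 0) => by
        obtain ⟨y, hy⟩ := (hr0 x).1 hx
        exact (congrArg g.1 hy).symm.trans (LinearMap.congr_fun g.2 y)
    exact ⟨c, LinearMap.ext hc⟩
  have hb0 : ∀ g, b g = 0 ↔ g.1 ∘ₗ (LinearMap.ker (res.d (m + 1)).dualMap).subtype = 0 := fun g => by
    rw [← map_eq_zero_iff _ hr_inj, hb]
    rfl
  obtain ⟨β, hβ⟩ := LinearMap.exists_comp_eq_of_surjective t ht b fun g hg => by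
    obtain ⟨y, hy⟩ := (ht0 g).1 hg
    rw [hb0, ← hy]
    exact LinearMap.ext fun z => (congrArg y z.2).trans (map_zero y)
  refine ⟨α, β, q ∘ₗ LinearMap.lcomp R N r, ?_, fun z => ?_, fun c => ?_⟩
  · rw [injective_iff_map_eq_zero]
    intro z hz
    obtain ⟨f, rfl⟩ := hp z
    rw [hα] at hz
    exact (hp0 f).2 ((ht0 _).1 hz)
  · obtain ⟨g, rfl⟩ := ht z
    rw [hβ, hb0]
    constructor
    · intro hg
      exact ⟨p ⟨g.1, hg⟩, hα _⟩
    · rintro ⟨y, hy⟩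
      obtain ⟨f, rfl⟩ := hp y
      rw [← hb0, ← hβ, ← hy, hα, LinearMap.comp_apply, hβ, hb0]
      exact f.2
  · refine (hq0 (LinearMap.lcomp R N r c)).trans ⟨?_, ?_⟩
    · rintro ⟨g, hg⟩
      have hgm : g ∈ LinearMap.ker (LinearMap.lcomp R N (res.d m).dualMap) :=
        LinearMap.ext fun y => by
          refine (LinearMap.congr_fun hg ⟨_, hdd y⟩).trans ?_
          exact (congrArg c ((hr0 _).2 ⟨y, rfl⟩)).trans (map_zero c)
      exact ⟨t ⟨g, hgm⟩, hr_inj ((congrArg _ (hβ _)).trans ((hb _).trans hg))⟩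
    · rintro ⟨z, rfl⟩
      obtain ⟨g, rfl⟩ := ht z
      exact ⟨g.1, by rw [hβ, hb]; rfl⟩
end

section
/- Let R be a commutative Noetherian local ring, let M and N be finitely generated R-modules, and fix a resolution ⋯ → F_2 → F_1 → F_0 → M → 0 of M by finite free R-modules. If Tor_i^R(M,N) = 0 for all i ≥ 1, then Ext^1_R(Tr Ω^i M, N) = 0 for all i ≥ 1. -/
open CategoryTheory

open TensorProduct

/-- A diagram chase in the tensor product of the short exact sequence `K → F → M` with a complex
`A → B → C → D`. -/
theorem mem_range_lTensor_of_map_eq_zero {R : Type*} [CommRing R]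
    {K F M A B C D : Type*} [AddCommGroup K] [Module R K] [AddCommGroup F] [Module R F]
    [AddCommGroup M] [Module R M] [AddCommGroup A] [Module R A] [AddCommGroup B] [Module R B]
    [AddCommGroup C] [Module R C] [AddCommGroup D] [Module R D]
    [Module.Flat R F] [Module.Flat R C]
    {f : K →ₗ[R] F} {g : F →ₗ[R] M} (hf : Function.Injective f) (hfg : Function.Exact f g)
    (hg : Function.Surjective g)
    {a : A →ₗ[R] B} {b : B →ₗ[R] C} {c : C →ₗ[R] D} (hab : b ∘ₗ a = 0)
    (hbc : Function.Exact b c)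
    (hM : Function.Exact (a.lTensor M) (b.lTensor M))
    (x : K ⊗[R] C) (hx : TensorProduct.map f c x = 0) :
    x ∈ LinearMap.range (b.lTensor K) := by
  have hF := Module.Flat.lTensor_exact F hbc
  obtain ⟨y, hy⟩ := (hF (f.rTensor C x)).1 (by
    rw [← LinearMap.comp_apply, LinearMap.lTensor_comp_rTensor, hx])
  obtain ⟨z, hz⟩ := (hM (g.rTensor B y)).1 (by
    rw [← LinearMap.comp_apply, LinearMap.lTensor_comp_rTensor, ← LinearMap.rTensor_comp_lTensor,
      LinearMap.comp_apply, hy, ← LinearMap.comp_apply, ← LinearMap.rTensor_comp,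
      hfg.linearMap_comp_eq_zero, LinearMap.rTensor_zero, LinearMap.zero_apply])
  obtain ⟨z', rfl⟩ := LinearMap.rTensor_surjective A hg z
  obtain ⟨w, hw⟩ := (rTensor_exact B hfg hg (y - a.lTensor F z')).1 (by
    rw [map_sub, ← hz, sub_eq_zero, ← LinearMap.comp_apply, ← LinearMap.comp_apply,
      LinearMap.lTensor_comp_rTensor, LinearMap.rTensor_comp_lTensor])
  refine ⟨w, Module.Flat.rTensor_preserves_injective_linearMap f hf ?_⟩
  rw [← LinearMap.comp_apply, LinearMap.rTensor_comp_lTensor, ← LinearMap.lTensor_comp_rTensor,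
    LinearMap.comp_apply, hw, map_sub, hy, ← LinearMap.comp_apply, ← LinearMap.lTensor_comp,
    hab, LinearMap.lTensor_zero, LinearMap.zero_apply, sub_zero]

section DimensionShift

variable {R : Type*} [CommRing R] {Q : ℕ → Type*} [∀ n, AddCommGroup (Q n)] [∀ n, Module R (Q n)]
  {q : ∀ n, Q (n + 1) →ₗ[R] Q n} {N : Type*} [AddCommGroup N] [Module R N] {e : Q 0 →ₗ[R] N}
  {K F M : Type*} [AddCommGroup K] [Module R K] [AddCommGroup F] [Module R F]
  [AddCommGroup M] [Module R M] {f : K →ₗ[R] F} {g : F →ₗ[R] M}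

/-- Acyclicity of `M ⊗ Q` passes to a syzygy `K` of `M`, for `Q` a flat resolution. -/
theorem exact_lTensor_of_shortExact [∀ n, Module.Flat R (Q n)] [Module.Flat R F]
    (hq : ∀ n, Function.Exact (q (n + 1)) (q n))
    (hf : Function.Injective f) (hfg : Function.Exact f g) (hg : Function.Surjective g)
    (hM : ∀ n, Function.Exact ((q (n + 1)).lTensor M) ((q n).lTensor M)) (n : ℕ) :
    Function.Exact ((q (n + 1)).lTensor K) ((q n).lTensor K) := by
  refine fun x ↦ ⟨fun hx ↦ ?_, ?_⟩
  · refine mem_range_lTensor_of_map_eq_zero hf hfg hg (hq (n + 1)).linearMap_comp_eq_zero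
      (hq n) (hM (n + 1)) x ?_
    rw [← LinearMap.rTensor_comp_lTensor, LinearMap.comp_apply, hx, map_zero]
  · rintro ⟨y, rfl⟩
    rw [← LinearMap.comp_apply, ← LinearMap.lTensor_comp, (hq n).linearMap_comp_eq_zero,
      LinearMap.lTensor_zero, LinearMap.zero_apply]

/-- If `M ⊗ Q` is acyclic for a flat resolution `Q` of `N`, then tensoring `0 → K → F → M → 0`
with `N` preserves injectivity. -/
theorem rTensor_injective_of_shortExact [∀ n, Module.Flat R (Q n)] [Module.Flat R F]
    (hq : ∀ n, Function.Exact (q (n + 1)) (q n)) (hqe : Function.Exact (q 0) e)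
    (he : Function.Surjective e)
    (hf : Function.Injective f) (hfg : Function.Exact f g) (hg : Function.Surjective g)
    (hM : Function.Exact ((q 1).lTensor M) ((q 0).lTensor M)) :
    Function.Injective (f.rTensor N) := by
  rw [injective_iff_map_eq_zero]
  intro x hx
  obtain ⟨x, rfl⟩ := LinearMap.lTensor_surjective K he x
  obtain ⟨y, rfl⟩ := mem_range_lTensor_of_map_eq_zero hf hfg hg (hq 0).linearMap_comp_eq_zero
    hqe hM x (by rw [← LinearMap.rTensor_comp_lTensor, LinearMap.comp_apply, hx])
  rw [← LinearMap.comp_apply, ← LinearMap.lTensor_comp, hqe.linearMap_comp_eq_zero,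
    LinearMap.lTensor_zero, LinearMap.zero_apply]

end DimensionShift

/-- If `M ⊗ Q` is acyclic for a flat resolution `Q` of `N`, then `F ⊗ N` is acyclic for
a finite free resolution `F` of `M`. -/
theorem FiniteFreeResolution.exact_rTensor {R : Type} [CommRing R] {M : Type}
    [AddCommGroup M] [Module R M] (res : FiniteFreeResolution R M)
    {Q : ℕ → Type*} [∀ n, AddCommGroup (Q n)] [∀ n, Module R (Q n)] [∀ n, Module.Flat R (Q n)]
    {q : ∀ n, Q (n + 1) →ₗ[R] Q n} {N : Type*} [AddCommGroup N] [Module R N] {e : Q 0 →ₗ[R] N}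
    (hq : ∀ n, Function.Exact (q (n + 1)) (q n)) (hqe : Function.Exact (q 0) e)
    (he : Function.Surjective e)
    (hM : ∀ n, Function.Exact ((q (n + 1)).lTensor M) ((q n).lTensor M)) (i : ℕ) :
    Function.Exact ((res.d (i + 1)).rTensor N) ((res.d i).rTensor N) := by
  have := res.free
  have h0 : Function.Exact (LinearMap.range (res.d 0)).subtype res.ε := fun x ↦ by
    simpa using res.exact_at_zero x
  have h1 (n : ℕ) : Function.Exact (LinearMap.range (res.d (n + 1))).subtype
      (res.d n).rangeRestrict := fun x ↦ by
    simpa [Subtype.ext_iff] using res.exact_at n x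
  have hd (n : ℕ) : Function.Exact (res.d (n + 1)) (res.d n).rangeRestrict := fun x ↦ by
    simpa [Subtype.ext_iff] using res.exact_at n x
  have hK (n : ℕ) : ∀ k, Function.Exact ((q (k + 1)).lTensor (LinearMap.range (res.d n)))
      ((q k).lTensor (LinearMap.range (res.d n))) := by
    induction n with
    | zero => exact exact_lTensor_of_shortExact hq (Submodule.injective_subtype _) h0 res.surj hM
    | succ n ih =>
      exact exact_lTensor_of_shortExact hq (Submodule.injective_subtype _) (h1 n)
        (LinearMap.surjective_rangeRestrict _) ih
  have hinj : Function.Injective ((LinearMap.range (res.d i)).subtype.rTensor N) := by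
    cases i with
    | zero =>
      exact rTensor_injective_of_shortExact hq hqe he (Submodule.injective_subtype _) h0
        res.surj (hM 0)
    | succ n =>
      exact rTensor_injective_of_shortExact hq hqe he (Submodule.injective_subtype _) (h1 n)
        (LinearMap.surjective_rangeRestrict _) (hK n 0)
  have hcomp : (res.d i).rTensor N = (LinearMap.range (res.d i)).subtype.rTensor N ∘ₗ
      (res.d i).rangeRestrict.rTensor N := by
    rw [← LinearMap.rTensor_comp]
    rfl
  rw [hcomp, LinearMap.coe_comp]
  exact (rTensor_exact N (hd i) (LinearMap.surjective_rangeRestrict _)).comp_injective _ hinj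
    (map_zero _)

/-- The natural map `F ⊗ N → Hom(F^*, N)`. -/
noncomputable def tensorToHomDual (R F N : Type*) [CommRing R] [AddCommGroup F] [Module R F]
    [AddCommGroup N] [Module R N] : F ⊗[R] N →ₗ[R] (Module.Dual R F →ₗ[R] N) :=
  dualTensorHom R (Module.Dual R F) N ∘ₗ (Module.Dual.eval R F).rTensor N

section TensorToHomDual

variable {R : Type*} [CommRing R] {F G H N : Type*} [AddCommGroup F] [Module R F]
  [AddCommGroup G] [Module R G] [AddCommGroup H] [Module R H] [AddCommGroup N] [Module R N]

theorem tensorToHomDual_bijective [Module.Free R F] [Module.Finite R F] :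
    Function.Bijective (tensorToHomDual R F N) := by
  have h1 : Function.Bijective (dualTensorHom R (Module.Dual R F) N) := by
    exact (dualTensorHomEquiv R (Module.Dual R F) N).bijective
  exact h1.comp ((Module.evalEquiv R F).rTensor N).bijective

theorem tensorToHomDual_rTensor (d : F →ₗ[R] G) (x : F ⊗[R] N) :
    tensorToHomDual R G N (d.rTensor N x) = tensorToHomDual R F N x ∘ₗ d.dualMap := by
  induction x with
  | zero => simp
  | add x y hx hy => simp only [map_add, hx, hy, LinearMap.add_comp]
  | tmul x n => ext φ; simp [tensorToHomDual]

/-- If `F ⊗ N → G ⊗ N → H ⊗ N` is exact, every map from the image of `G^* → F^*` to `N` extends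
to `F^*`. -/
theorem exists_extend_of_exact_rTensor [Module.Free R F] [Module.Finite R F] [Module.Free R G]
    [Module.Finite R G] [Module.Free R H] [Module.Finite R H] {d : F →ₗ[R] G} {d' : G →ₗ[R] H}
    (hd : d' ∘ₗ d = 0) (hN : Function.Exact (d.rTensor N) (d'.rTensor N))
    (f : LinearMap.range d.dualMap →ₗ[R] N) :
    ∃ h : Module.Dual R F →ₗ[R] N, h ∘ₗ (LinearMap.range d.dualMap).subtype = f := by
  obtain ⟨x, hx⟩ := (tensorToHomDual_bijective (F := G)).2 (f ∘ₗ d.dualMap.rangeRestrict)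
  obtain ⟨y, rfl⟩ := (hN x).1 (tensorToHomDual_bijective.1 (by
    rw [tensorToHomDual_rTensor, hx, map_zero]
    ext φ
    have : d.dualMap.rangeRestrict (d'.dualMap φ) = 0 := by
      ext v
      simpa using congrArg φ (LinearMap.congr_fun hd v)
    simp [this]))
  refine ⟨tensorToHomDual R F N y, ?_⟩
  rw [tensorToHomDual_rTensor] at hx
  ext ⟨_, φ, rfl⟩
  exact LinearMap.congr_fun hx φ

end TensorToHomDual

/-- If maps to `N` from the kernel of one surjection from a projective module
onto `T` extend, then so do those from
the kernel of any other. -/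
theorem exists_extend_ker_of_projective {R G P T N : Type*} [Ring R] [AddCommGroup G]
    [Module R G] [AddCommGroup P] [Module R P] [AddCommGroup T] [Module R T] [AddCommGroup N]
    [Module R N] [Module.Projective R G] [Module.Projective R P] {π : G →ₗ[R] T} {ρ : P →ₗ[R] T}
    (hπ : Function.Surjective π) (hρ : Function.Surjective ρ)
    (hG : ∀ f : LinearMap.ker π →ₗ[R] N, ∃ h : G →ₗ[R] N, h ∘ₗ (LinearMap.ker π).subtype = f)
    (f : LinearMap.ker ρ →ₗ[R] N) :
    ∃ h : P →ₗ[R] N, h ∘ₗ (LinearMap.ker ρ).subtype = f := by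
  obtain ⟨α, hα⟩ := Module.projective_lifting_property ρ π hρ
  obtain ⟨β, hβ⟩ := Module.projective_lifting_property π ρ hπ
  have hα' (x : G) : ρ (α x) = π x := LinearMap.congr_fun hα x
  have hβ' (x : P) : π (β x) = ρ x := LinearMap.congr_fun hβ x
  obtain ⟨h, hh⟩ := hG (f ∘ₗ α.restrict (p := LinearMap.ker π) (q := LinearMap.ker ρ)
    fun x hx ↦ by simpa [hα'] using hx)
  let γ : P →ₗ[R] LinearMap.ker ρ := (LinearMap.id - α ∘ₗ β).codRestrict _ fun x ↦ by
    simp [hα', hβ']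
  refine ⟨h ∘ₗ β + f ∘ₗ γ, ?_⟩
  ext ⟨x, hx⟩
  have hx' : β x ∈ LinearMap.ker π := by simpa [hβ'] using hx
  have hβx := LinearMap.congr_fun hh ⟨β x, hx'⟩
  simp only [LinearMap.comp_apply, Submodule.subtype_apply] at hβx
  simp only [LinearMap.comp_apply, Submodule.subtype_apply, LinearMap.add_apply, hβx]
  rw [← map_add]
  congr 1
  ext
  simp [γ]


namespace CategoryTheory.ProjectiveResolution

variable {R : Type} [CommRing R] {X : ModuleCat.{0} R} (P : ProjectiveResolution X)

theorem function_exact_d (n : ℕ) : Function.Exact (P.complex.d (n + 2) (n + 1)).hom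
    (P.complex.d (n + 1) n).hom :=
  (ShortComplex.ShortExact.moduleCat_exact_iff_function_exact _).1 (P.exact_succ n)

/-- The augmentation of a projective resolution of modules, as a linear map. -/
noncomputable def augmentation_s4 : P.complex.X 0 →ₗ[R] X := (P.π.f 0).hom

theorem function_exact_augmentation : Function.Exact (P.complex.d 1 0).hom P.augmentation_s4 :=
  (ShortComplex.ShortExact.moduleCat_exact_iff_function_exact _).1 P.exact₀

theorem augmentation_surjective_s4 : Function.Surjective P.augmentation_s4 :=
  (ModuleCat.epi_iff_surjective (P.π.f 0)).1 inferInstance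

theorem module_projective (n : ℕ) : Module.Projective R (P.complex.X n) :=
  (IsProjective.iff_projective _).2 (P.projective n)

end CategoryTheory.ProjectiveResolution

theorem exact_lTensor_of_subsingleton_torMod {R : Type} [CommRing R] {M N : Type}
    [AddCommGroup M] [Module R M] [AddCommGroup N] [Module R N]
    (P : ProjectiveResolution (ModuleCat.of R N)) (n : ℕ)
    (h : Subsingleton (torMod R (n + 1) M N)) :
    Function.Exact ((P.complex.d (n + 2) (n + 1)).hom.lTensor M)
      ((P.complex.d (n + 1) n).hom.lTensor M) := by
  have h0 := (ModuleCat.isZero_of_subsingleton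
    (((Tor (ModuleCat R) (n + 1)).obj (ModuleCat.of R M)).obj (ModuleCat.of R N))).of_iso
    (P.isoLeftDerivedObj ((MonoidalCategory.tensoringLeft (ModuleCat R)).obj
      (ModuleCat.of R M)) (n + 1)).symm
  have h1 := (HomologicalComplex.exactAt_iff' _ (n + 2) (n + 1) n (by simp) (by simp)).1
    ((HomologicalComplex.exactAt_iff_isZero_homology _ _).2 h0)
  exact (ShortComplex.ShortExact.moduleCat_exact_iff_function_exact _).1 h1

theorem subsingleton_extMod_one_of_exists_extend {R : Type} [CommRing R] {T N : Type}
    [AddCommGroup T] [Module R T] [AddCommGroup N] [Module R N]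
    (P : ProjectiveResolution (ModuleCat.of R T))
    (h : ∀ f : LinearMap.ker P.augmentation_s4 →ₗ[R] N, ∃ g : P.complex.X 0 →ₗ[R] N,
      g ∘ₗ (LinearMap.ker P.augmentation_s4).subtype = f) :
    Subsingleton (extMod R 1 T N) := by
  refine ModuleCat.subsingleton_of_isZero (Limits.IsZero.of_iso ?_ (P.isoExt 1 (ModuleCat.of R N)))
  rw [← HomologicalComplex.exactAt_iff_isZero_homology,
    HomologicalComplex.exactAt_iff' _ 0 1 2 (by simp) (by simp),
    ShortComplex.moduleCat_exact_iff]
  intro (f : P.complex.X 1 ⟶ ModuleCat.of R N) (hf : P.complex.d 2 1 ≫ f = 0)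
  let p : P.complex.X 1 →ₗ[R] LinearMap.ker P.augmentation_s4 :=
    (P.complex.d 1 0).hom.codRestrict _ P.function_exact_augmentation.apply_apply_eq_zero
  have hp : Function.Surjective p := fun ⟨x, hx⟩ ↦ by
    obtain ⟨y, rfl⟩ := (P.function_exact_augmentation x).1 hx
    exact ⟨y, rfl⟩
  have hker : LinearMap.ker p ≤ LinearMap.ker f.hom := fun x hx ↦ by
    have hx' : (P.complex.d 1 0).hom x = 0 := congrArg Subtype.val (LinearMap.mem_ker.1 hx)
    obtain ⟨y, rfl⟩ := (P.function_exact_d 0 x).1 hx'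
    exact LinearMap.congr_fun (congrArg ModuleCat.Hom.hom hf) y
  obtain ⟨g, hg⟩ := h ((LinearMap.ker p).liftQ f.hom hker ∘ₗ
    (p.quotKerEquivOfSurjective hp).symm.toLinearMap)
  refine ⟨ModuleCat.ofHom g, ModuleCat.hom_ext (LinearMap.ext fun x ↦ ?_)⟩
  have hx := LinearMap.congr_fun hg (p x)
  have hs : (p.quotKerEquivOfSurjective hp).symm (p x) = Submodule.Quotient.mk x := by
    rw [LinearEquiv.symm_apply_eq]; rfl
  simp only [LinearMap.comp_apply, LinearEquiv.coe_coe, hs, Submodule.liftQ_apply] at hx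
  exact hx

/-- If `Tor_i^R(M, N) = 0` for all `i ≥ 1`, then `Ext^1_R(Tr Ω^i M, N) = 0`
for all `i ≥ 1`. -/
theorem ext_one_trSyzygy_vanishing_of_tor_vanishing
    (R : Type) [CommRing R] [IsNoetherianRing R] [IsLocalRing R]
    (M N : Type) [AddCommGroup M] [Module R M] [AddCommGroup N] [Module R N]
    [Module.Finite R M] [Module.Finite R N]
    (res : FiniteFreeResolution R M)
    (htor : ∀ i : ℕ, 1 ≤ i → Subsingleton (torMod R i M N)) :
    ∀ i : ℕ, 1 ≤ i → Subsingleton (extMod R 1 (res.trSyzygy i) N) := by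
  intro i hi
  obtain ⟨i, rfl⟩ := Nat.exists_eq_add_of_le' hi
  have := res.free
  have := res.finite
  obtain ⟨P⟩ := HasProjectiveResolution.out (Z := ModuleCat.of R N)
  obtain ⟨Q⟩ := HasProjectiveResolution.out (Z := ModuleCat.of R (res.trSyzygy (i + 1)))
  have := P.module_projective
  have hN : Function.Exact ((res.d (i + 1)).rTensor N) ((res.d i).rTensor N) :=
    res.exact_rTensor (Q := fun n ↦ P.complex.X n) (q := fun n ↦ (P.complex.d (n + 1) n).hom)
      P.function_exact_d P.function_exact_augmentation P.augmentation_surjective_s4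
      (fun n ↦ exact_lTensor_of_subsingleton_torMod P n (htor (n + 1) n.succ_pos)) i
  have hG := exists_extend_of_exact_rTensor (res.exact_at i).linearMap_comp_eq_zero hN
  rw [← Submodule.ker_mkQ (LinearMap.range (res.d (i + 1)).dualMap)] at hG
  have hproj := Q.module_projective 0
  have hsurj := Q.augmentation_surjective_s4
  have hQ := exists_extend_ker_of_projective (Submodule.mkQ_surjective _) hsurj hG
  exact subsingleton_extMod_one_of_exists_extend Q hQ
end

section
/- Let R be a commutative Noetherian local ring, let M and N be finitely generated R-modules, fix a resolution ⋯ → F_2 → F_1 → F_0 → M → 0 of M by finite free R-modules, and let n ≥ 1 be an integer. If Ext^i_R(M,R) = 0 for all i ≥ n, then for every integer j ≥ n one has Ext^j_R(M,N) ≅ Tor_1^R(Tr Ω^j M, N). -/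
open CategoryTheory

namespace CategoryTheory.ShortComplex

/-- If `p : X₂ → Q` is a cokernel of `f`, the homology of a short complex of modules is the kernel
of the map `Q → X₃` induced by `g`. -/
lemma nonempty_homology_linearEquiv_ker.{u, v, w} {R : Type u} [CommRing R]
    (S : ShortComplex (ModuleCat.{v} R)) {Q : Type w} [AddCommGroup Q] [Module R Q]
    (p : S.X₂ →ₗ[R] Q) (hp : Function.Surjective p) (hfp : Function.Exact S.f.hom p)
    (q : Q →ₗ[R] S.X₃) (hq : q ∘ₗ p = S.g.hom) :
    Nonempty (S.homology ≃ₗ[R] LinearMap.ker q) := by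
  have hqp (x : S.X₂) : q (p x) = S.g.hom x := LinearMap.congr_fun hq x
  let r : LinearMap.ker S.g.hom →ₗ[R] LinearMap.ker q :=
    (p ∘ₗ (LinearMap.ker S.g.hom).subtype).codRestrict _ fun x => (hqp _).trans x.2
  have hr : Function.Surjective r := fun ⟨y, hy⟩ => by
    obtain ⟨x, rfl⟩ := hp y
    exact ⟨⟨x, (hqp x).symm.trans hy⟩, rfl⟩
  have hker : LinearMap.range S.moduleCatToCycles = LinearMap.ker r := by
    ext ⟨x, hx⟩
    exact ⟨fun ⟨y, hy⟩ => Subtype.ext ((hfp x).2 ⟨y, congrArg Subtype.val hy⟩), fun h =>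
      let ⟨y, hy⟩ := (hfp x).1 (congrArg Subtype.val h)
      ⟨y, Subtype.ext hy⟩⟩
  exact ⟨S.moduleCatHomologyIso.toLinearEquiv ≪≫ₗ Submodule.quotEquivOfEq _ _ hker ≪≫ₗ
    r.quotKerEquivOfSurjective hr⟩

end CategoryTheory.ShortComplex

namespace FiniteFreeResolution

variable {R : Type} [CommRing R] {M : Type} [AddCommGroup M] [Module R M]
  (res : FiniteFreeResolution R M)

attribute [instance] FiniteFreeResolution.free FiniteFreeResolution.finite

/-- The chain complex of modules underlying a finite free resolution. -/
noncomputable def chainComplex : ChainComplex (ModuleCat.{0} R) ℕ :=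
  ChainComplex.of (fun n => ModuleCat.of R (res.F n)) (fun n => ModuleCat.ofHom (res.d n))
    fun n => by
      rw [← ModuleCat.ofHom_comp, (res.exact_at n).linearMap_comp_eq_zero]
      rfl

lemma chainComplex_d (n : ℕ) :
    res.chainComplex.d (n + 1) n = ModuleCat.ofHom (res.d n) := by
  simp [chainComplex]

/-- A finite free resolution, as a projective resolution in the category of modules. -/
noncomputable def projectiveResolution : ProjectiveResolution (ModuleCat.of R M) where
  complex := res.chainComplex
  projective n := inferInstanceAs (Projective (ModuleCat.of R (res.F n)))
  π := (ChainComplex.toSingle₀Equiv _ _).symm ⟨ModuleCat.ofHom res.ε, by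
    rw [chainComplex_d]
    ext x
    exact res.exact_at_zero.apply_apply_eq_zero x⟩
  quasiIso := ⟨fun n => by
    cases n with
    | zero =>
      rw [ChainComplex.quasiIsoAt₀_iff, ShortComplex.quasiIso_iff_of_zeros' _ rfl rfl rfl]
      constructor
      · rw [ShortComplex.moduleCat_exact_iff_range_eq_ker]
        simpa [chainComplex_d] using! res.exact_at_zero.linearMap_ker_eq.symm
      · rw [ModuleCat.epi_iff_surjective]
        simpa using! res.surj
    | succ m =>
      rw [quasiIsoAt_iff_exactAt' (hL := ChainComplex.exactAt_succ_single_obj ..),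
        HomologicalComplex.exactAt_iff' _ (m + 2) (m + 1) m (by simp) (by simp),
        ShortComplex.moduleCat_exact_iff_range_eq_ker]
      simpa [chainComplex_d] using! (res.exact_at m).linearMap_ker_eq.symm⟩

/-- `Ext^{k+1}(M, N)` computed from a finite free resolution: if `p` is a cokernel of
`Hom(F_k, N) → Hom(F_{k+1}, N)`, it is the kernel of the induced map to `Hom(F_{k+2}, N)`. -/
lemma nonempty_ext_linearEquiv_ker {N : Type} [AddCommGroup N] [Module R N] (k : ℕ)
    {Q : Type} [AddCommGroup Q] [Module R Q] (p : (res.F (k + 1) →ₗ[R] N) →ₗ[R] Q)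
    (hp : Function.Surjective p)
    (hfp : Function.Exact ((res.d k).lcomp R N) p)
    (q : Q →ₗ[R] (res.F (k + 2) →ₗ[R] N)) (hq : q ∘ₗ p = (res.d (k + 1)).lcomp R N) :
    Nonempty (extMod R (k + 1) M N ≃ₗ[R] LinearMap.ker q) := by
  let P := res.projectiveResolution
  let K := P.complex.linearYonedaObj R (ModuleCat.of R N)
  let e (n : ℕ) : K.X n ≃ₗ[R] (res.F n →ₗ[R] N) := ModuleCat.homLinearEquiv (S := R)
  have he (n : ℕ) (x : K.X n) : e (n + 1) (K.d n (n + 1) x) = (res.d n).lcomp R N (e n x) :=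
    congrArg (fun d => (e n x) ∘ₗ d.hom) (res.chainComplex_d n)
  obtain ⟨E⟩ := (K.sc' k (k + 1) (k + 2)).nonempty_homology_linearEquiv_ker
    (p ∘ₗ (e (k + 1)).toLinearMap) (hp.comp (e (k + 1)).surjective)
    (fun y => (hfp (e (k + 1) y)).trans ⟨fun ⟨x, hx⟩ => ⟨(e k).symm x, (e (k + 1)).injective
      (by rw [← hx]; exact (he k _).trans (by rw [LinearEquiv.apply_symm_apply]))⟩,
      fun ⟨x, hx⟩ => ⟨e k x, by rw [← hx]; exact (he k x).symm⟩⟩)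
    ((e (k + 2)).symm.toLinearMap ∘ₗ q)
    (LinearMap.ext fun x => (e (k + 2)).injective <| by
      refine Eq.trans ?_ (he (k + 1) x).symm
      exact ((e (k + 2)).apply_symm_apply _).trans (LinearMap.congr_fun hq _))
  exact ⟨((P.isoExt (k + 1) (ModuleCat.of R N)) ≪≫ K.homologyIsoSc' k (k + 1) (k + 2)
    (by simp) (by simp)).toLinearEquiv ≪≫ₗ E ≪≫ₗ LinearEquiv.ofEq _ _
      (LinearEquiv.ker_comp _ _)⟩

end FiniteFreeResolution

open TensorProduct

section Tensor

variable {R : Type*} [CommRing R] {Z A T K P N : Type*}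
  [AddCommGroup Z] [Module R Z] [AddCommGroup A] [Module R A] [AddCommGroup T] [Module R T]
  [AddCommGroup K] [Module R K] [AddCommGroup P] [Module R P] [AddCommGroup N] [Module R N]

/-- Balancing of `Tor₁`: if `0 → Z → A → T → 0` and `0 → K → P → N → 0` are exact with `A` and `P`
flat, then `Tor₁(T, N)` can be computed from either sequence. -/
lemma nonempty_ker_rTensor_linearEquiv_ker_lTensor [Module.Flat R A] [Module.Flat R P]
    {α : Z →ₗ[R] A} {β : A →ₗ[R] T} (hα : Function.Injective α) (hαβ : Function.Exact α β)
    (hβ : Function.Surjective β)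
    {ι : K →ₗ[R] P} {π : P →ₗ[R] N} (hι : Function.Injective ι) (hιπ : Function.Exact ι π)
    (hπ : Function.Surjective π) :
    Nonempty (LinearMap.ker (α.rTensor N) ≃ₗ[R] LinearMap.ker (ι.lTensor T)) := by
  have hP : Function.Injective (α.rTensor P) :=
    Module.Flat.rTensor_preserves_injective_linearMap _ hα
  have hA : Function.Injective (ι.lTensor A) :=
    Module.Flat.lTensor_preserves_injective_linearMap _ hι
  let δ := SnakeLemma.δ' (α.rTensor K) (α.rTensor P) (α.rTensor N) (ι.lTensor Z) (π.lTensor Z)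
    (lTensor_exact Z hιπ hπ) (ι.lTensor A) (π.lTensor A) (lTensor_exact A hιπ hπ)
    (by simp) (by simp) (LinearMap.ker (α.rTensor N)).subtype (LinearMap.exact_subtype_ker_map _)
    (β.rTensor K) (rTensor_exact K hαβ hβ) (LinearMap.lTensor_surjective Z hπ) hA
  have hδ : Function.Exact (0 : PUnit.{1} →ₗ[R] _) δ := by
    intro x
    refine SnakeLemma.exact_δ'_right (ι₂ := (0 : PUnit.{1} →ₗ[R] _))
      (hι₂ := (LinearMap.exact_zero_iff_injective _ _).2 hP)
      (hF := ?_) (h := Subtype.val_injective) ..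
    simp
  have hδι : Function.Exact δ (ι.lTensor T) := by
    intro x
    exact SnakeLemma.exact_δ'_left (π₂ := β.rTensor P) (hπ₂ := rTensor_exact P hαβ hβ)
      (hF := by simp) (h := LinearMap.rTensor_surjective K hβ) ..
  exact ⟨LinearEquiv.ofInjective δ ((LinearMap.exact_zero_iff_injective _ _).1 hδ) ≪≫ₗ
    LinearEquiv.ofEq _ _ hδι.linearMap_ker_eq.symm⟩

end Tensor

section Tor

variable {R : Type} [CommRing R] {T N : Type} [AddCommGroup T] [Module R T]
  [AddCommGroup N] [Module R N]

variable (R T N) in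
/-- `Tor₁(T, N)` is the kernel of `T ⊗ K → T ⊗ P` for some short exact sequence
`0 → K → P → N → 0` with `P` flat. -/
lemma exists_tor_one_linearEquiv_ker_lTensor :
    ∃ (K P : ModuleCat.{0} R) (ι : K →ₗ[R] P) (π : P →ₗ[R] N), Module.Flat R P ∧
      Function.Injective ι ∧ Function.Exact ι π ∧ Function.Surjective π ∧
      Nonempty (torMod R 1 T N ≃ₗ[R] LinearMap.ker (ι.lTensor T)) := by
  let S := ProjectiveResolution.of (ModuleCat.of R N)
  let d₂ := (S.complex.d 2 1).hom
  let d₁ := (S.complex.d 1 0).hom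
  have hd : LinearMap.range d₂ = LinearMap.ker d₁ :=
    (ShortComplex.moduleCat_exact_iff_range_eq_ker _).1 (S.exact_succ 0)
  let π : S.complex.X 0 →ₗ[R] N := (S.π.f 0).hom
  have hd₀ : LinearMap.range d₁ = LinearMap.ker π :=
    (ShortComplex.moduleCat_exact_iff_range_eq_ker _).1 S.exact₀
  let ι : (S.complex.X 1 ⧸ LinearMap.range d₂) →ₗ[R] S.complex.X 0 :=
    (LinearMap.range d₂).liftQ d₁ hd.le
  have : Module.Projective R (S.complex.X 0) :=
    (IsProjective.iff_projective _).2 (S.projective 0)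
  let F := (MonoidalCategory.tensoringLeft (ModuleCat.{0} R)).obj (ModuleCat.of R T)
  let L := (F.mapHomologicalComplex _).obj S.complex
  obtain ⟨E⟩ := (L.sc' 2 1 0).nonempty_homology_linearEquiv_ker
    ((LinearMap.range d₂).mkQ.lTensor T)
    (LinearMap.lTensor_surjective T (Submodule.mkQ_surjective _))
    (lTensor_exact T (LinearMap.exact_map_mkQ_range d₂) (Submodule.mkQ_surjective _))
    (ι.lTensor T)
    ((LinearMap.lTensor_comp T _ _).symm.trans
      (congrArg _ ((LinearMap.range d₂).liftQ_mkQ d₁ hd.le)))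
  refine ⟨ModuleCat.of R (S.complex.X 1 ⧸ LinearMap.range d₂), S.complex.X 0, ι, π,
    inferInstance, ?_, ?_, (ModuleCat.epi_iff_surjective _).1 inferInstance,
    ⟨(S.isoLeftDerivedObj F 1 ≪≫ L.homologyIsoSc' 2 1 0 (by simp) (by simp)).toLinearEquiv ≪≫ₗ E⟩⟩
  · rw [← LinearMap.ker_eq_bot, Submodule.ker_liftQ_eq_bot]
    exact hd.ge
  · exact LinearMap.exact_iff.2 (hd₀.symm.trans (Submodule.range_liftQ _ _ _).symm)

end Tor

/-- If `n ≥ 1` and `Ext^i_R(M, R) = 0` for all `i ≥ n`, then for every `j ≥ n`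
one has `Ext^j_R(M, N) ≅ Tor_1^R(Tr Ω^j M, N)`. -/
theorem ext_iso_tor_one_trSyzygy_of_ext_vanishing
    (R : Type) [CommRing R] [IsNoetherianRing R] [IsLocalRing R]
    (M N : Type) [AddCommGroup M] [Module R M] [AddCommGroup N] [Module R N]
    [Module.Finite R M] [Module.Finite R N]
    (res : FiniteFreeResolution R M) (n : ℕ) (hn : 1 ≤ n)
    (hext : ∀ i : ℕ, n ≤ i → Subsingleton (extMod R i M R)) :
    ∀ j : ℕ, n ≤ j →
      Nonempty (extMod R j M N ≃ₗ[R] torMod R 1 (res.trSyzygy j) N) := by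
  intro j hj
  obtain ⟨k, rfl⟩ : ∃ k, j = k + 1 := ⟨j - 1, by lia⟩
  have hdd : LinearMap.range (res.d k).dualMap ≤ LinearMap.ker (res.d (k + 1)).dualMap := by
    rw [LinearMap.range_le_ker_iff]
    ext f x
    simp [(res.exact_at k).apply_apply_eq_zero]
  let p := (LinearMap.range (res.d k).dualMap).mkQ
  let α := (LinearMap.range (res.d k).dualMap).liftQ (res.d (k + 1)).dualMap hdd
  have hpα : α ∘ₗ p = (res.d (k + 1)).dualMap := Submodule.liftQ_mkQ _ _ _
  have hp : Function.Surjective p := Submodule.mkQ_surjective _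
  have hdp : Function.Exact (res.d k).dualMap p := LinearMap.exact_map_mkQ_range _
  have hα : Function.Injective α := by
    obtain ⟨E⟩ := res.nonempty_ext_linearEquiv_ker k p hp hdp α hpα
    have := hext _ hj
    have := E.symm.subsingleton
    exact LinearMap.ker_eq_bot.1 Submodule.eq_bot_of_subsingleton
  have hαβ : Function.Exact α (LinearMap.range (res.d (k + 1)).dualMap).mkQ := by
    rw [LinearMap.exact_iff, Submodule.ker_mkQ]
    exact (Submodule.range_liftQ _ _ _).symm
  let e (i : ℕ) := dualTensorHomEquiv R (res.F i) N
  have he (i : ℕ) (x : Module.Dual R (res.F i) ⊗[R] N) :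
      e (i + 1) ((res.d i).dualMap.rTensor N x) = (res.d i).lcomp R N (e i x) := by
    induction x with
    | zero => simp
    | add x y hx hy => simp only [map_add, hx, hy]
    | tmul f y => ext; simp [e]
  obtain ⟨E⟩ := res.nonempty_ext_linearEquiv_ker k (p.rTensor N ∘ₗ (e (k + 1)).symm.toLinearMap)
    ((LinearMap.rTensor_surjective N hp).comp (e (k + 1)).symm.surjective)
    (fun y => (rTensor_exact N hdp hp ((e (k + 1)).symm y)).trans
      ⟨fun ⟨x, hx⟩ => ⟨e k x, by rw [← he, hx, LinearEquiv.apply_symm_apply]⟩,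
      fun ⟨x, hx⟩ => ⟨(e k).symm x, (e (k + 1)).injective (by simp [he, hx])⟩⟩)
    ((e (k + 2)).toLinearMap ∘ₗ α.rTensor N)
    (LinearMap.ext fun x => by
      obtain ⟨y, rfl⟩ := (e (k + 1)).surjective x
      rw [← he, ← hpα, LinearMap.rTensor_comp]
      simp)
  obtain ⟨K, P, ι, π, _, hι, hιπ, hπ, ⟨E'⟩⟩ :=
    exists_tor_one_linearEquiv_ker_lTensor R (res.trSyzygy (k + 1)) N
  obtain ⟨E''⟩ := nonempty_ker_rTensor_linearEquiv_ker_lTensor hα hαβ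
    (Submodule.mkQ_surjective _) hι hιπ hπ
  exact ⟨E ≪≫ₗ LinearEquiv.ofEq _ _ (LinearEquiv.ker_comp _ _) ≪≫ₗ E'' ≪≫ₗ E'.symm⟩
end

section
/- Let R be a commutative Noetherian local ring, let M and N be finitely generated R-modules, and fix a resolution ⋯ → F_2 → F_1 → F_0 → M → 0 of M by finite free R-modules. Suppose Ext^i_R(M,R) = 0 for all i ≥ 1 and Tor_i^R(M,N) = 0 for all i ≥ 1. Then for every integer t ≥ 2 and every integer j with 1 ≤ j ≤ t−1 one has Ext^j_R(Tr Ω^{t−1} M, N) = 0. -/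
open CategoryTheory

open TensorProduct

/-- A resolution of a module by projective modules, presented by linear maps. -/
structure LinearResolution (R : Type) [CommRing R] (X : Type) [AddCommGroup X] [Module R X] where
  F : ℕ → ModuleCat.{0} R
  projective : ∀ n, Module.Projective R (F n)
  d : ∀ n, F (n + 1) →ₗ[R] F n
  ε : F 0 →ₗ[R] X
  surj : Function.Surjective ε
  exact_at_zero : Function.Exact (d 0) ε
  exact_at : ∀ n, Function.Exact (d (n + 1)) (d n)

namespace LinearResolution

variable {R : Type} [CommRing R] {X : Type} [AddCommGroup X] [Module R X]

instance (res : LinearResolution R X) (n : ℕ) : Module.Projective R (res.F n) := res.projective n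

theorem nonempty : Nonempty (LinearResolution R X) := by
  let P := ProjectiveResolution.of (ModuleCat.of R X)
  exact ⟨{
    F := P.complex.X
    projective := fun n => (IsProjective.iff_projective _).2 (P.projective n)
    d := fun n => (P.complex.d (n + 1) n).hom
    ε := (P.π.f 0).hom
    surj := (ModuleCat.epi_iff_surjective _).1 inferInstance
    exact_at_zero := (ShortComplex.ShortExact.moduleCat_exact_iff_function_exact _).1 P.exact₀
    exact_at := fun n =>
      (ShortComplex.ShortExact.moduleCat_exact_iff_function_exact _).1 (P.exact_succ n) }⟩

/-- The chain complex underlying a resolution. -/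
noncomputable def complex (res : LinearResolution R X) : ChainComplex (ModuleCat.{0} R) ℕ :=
  ChainComplex.of res.F (fun n => ModuleCat.ofHom (res.d n)) fun n => by
    ext x
    exact (res.exact_at n).apply_apply_eq_zero x

theorem complex_d (res : LinearResolution R X) (n : ℕ) :
    res.complex.d (n + 1) n = ModuleCat.ofHom (res.d n) :=
  ChainComplex.of_d res.F (fun n => ModuleCat.ofHom (res.d n)) n

theorem complex_d_comp_ε (res : LinearResolution R X) :
    res.complex.d 1 0 ≫ (ModuleCat.ofHom res.ε : res.complex.X 0 ⟶ ModuleCat.of R X) = 0 := by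
  rw [res.complex_d 0]
  ext x
  exact res.exact_at_zero.apply_apply_eq_zero x

/-- The projective resolution in the sense of category theory given by a `LinearResolution`. -/
noncomputable def toProjectiveResolution (res : LinearResolution R X) :
    ProjectiveResolution (ModuleCat.of R X) where
  complex := res.complex
  projective n := (IsProjective.iff_projective _).1 (res.projective n)
  π := (ChainComplex.toSingle₀Equiv _ _).symm
    ⟨(ModuleCat.ofHom res.ε : res.complex.X 0 ⟶ _), res.complex_d_comp_ε⟩
  quasiIso := ⟨fun n => by
    cases n
    · rw [ChainComplex.quasiIsoAt₀_iff, ShortComplex.quasiIso_iff_of_zeros' _ rfl rfl rfl]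
      let S : ShortComplex (ModuleCat.{0} R) := ShortComplex.mk _ _ res.complex_d_comp_ε
      have hS : S.Exact := by
        refine (ShortComplex.ShortExact.moduleCat_exact_iff_function_exact _).2 ?_
        have := res.exact_at_zero
        dsimp only [S]
        rw [res.complex_d 0]
        exact this
      have hg : Epi S.g := (ModuleCat.epi_iff_surjective _).2 res.surj
      refine (ShortComplex.exact_and_epi_g_iff_of_iso ?_).2 ⟨hS, hg⟩
      exact ShortComplex.isoMk (Iso.refl _) (Iso.refl _) (Iso.refl _)
        ((Category.id_comp _).trans (Category.comp_id _).symm)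
        ((Category.id_comp _).trans
          ((ChainComplex.toSingle₀Equiv_symm_apply_f_zero (C := res.complex) _
            res.complex_d_comp_ε).symm.trans (Category.comp_id _).symm))
    · rename_i n
      rw [quasiIsoAt_iff_exactAt']
      · rw [HomologicalComplex.exactAt_iff' _ (n + 1 + 1) (n + 1) n (by simp) (by simp)]
        refine (ShortComplex.ShortExact.moduleCat_exact_iff_function_exact _).2 ?_
        have := res.exact_at n
        dsimp only [HomologicalComplex.sc', HomologicalComplex.shortComplexFunctor']
        rw [res.complex_d, res.complex_d]
        exact this
      · apply ChainComplex.exactAt_succ_single_obj⟩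

theorem subsingleton_ext_iff (res : LinearResolution R X) (N : Type) [AddCommGroup N] [Module R N]
    (k : ℕ) : Subsingleton (extMod R (k + 1) X N) ↔
      Function.Exact (fun g : res.F k →ₗ[R] N => g ∘ₗ res.d k)
        (fun g : res.F (k + 1) →ₗ[R] N => g ∘ₗ res.d (k + 1)) := by
  have e := res.toProjectiveResolution.isoExt (R := R) (k + 1) (ModuleCat.of R N)
  rw [e.toLinearEquiv.toEquiv.subsingleton_congr, ← ModuleCat.isZero_iff_subsingleton,
    ← HomologicalComplex.exactAt_iff_isZero_homology,
    HomologicalComplex.exactAt_iff' _ k (k + 1) (k + 2) (by simp) (by simp),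
    ShortComplex.ShortExact.moduleCat_exact_iff_function_exact]
  have hd (n : ℕ) (g : res.complex.X n ⟶ ModuleCat.of R N) :
      (res.complex.linearYonedaObj R (ModuleCat.of R N)).d n (n + 1) g =
        ModuleCat.ofHom (g.hom ∘ₗ res.d n : res.F (n + 1) →ₗ[R] N) := by
    change res.complex.d (n + 1) n ≫ g = _
    rw [res.complex_d]
    rfl
  change (∀ g : res.complex.X (k + 1) ⟶ ModuleCat.of R N,
    (res.complex.linearYonedaObj R (ModuleCat.of R N)).d (k + 1) (k + 2) g = 0 ↔
    ∃ h : res.complex.X k ⟶ ModuleCat.of R N,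
      (res.complex.linearYonedaObj R (ModuleCat.of R N)).d k (k + 1) h = g) ↔ _
  simp only [hd]
  have hinj (n : ℕ) (a b : res.F n →ₗ[R] N) : ModuleCat.ofHom a = ModuleCat.ofHom b ↔ a = b :=
    ⟨congrArg ModuleCat.Hom.hom, congrArg ModuleCat.ofHom⟩
  refine ⟨fun h g => ?_, fun h g => ?_⟩
  · refine ((hinj _ _ 0).symm.trans (h (ModuleCat.ofHom g))).trans ?_
    exact ⟨fun ⟨y, hy⟩ => ⟨y.hom, (hinj _ _ _).1 hy⟩,
      fun ⟨y, hy⟩ => ⟨ModuleCat.ofHom y, (hinj _ _ _).2 hy⟩⟩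
  · refine ((hinj _ _ 0).trans (h g.hom)).trans ?_
    exact ⟨fun ⟨y, hy⟩ => ⟨ModuleCat.ofHom y, (hinj _ _ _).2 hy⟩,
      fun ⟨y, hy⟩ => ⟨y.hom, (hinj _ _ _).1 hy⟩⟩

theorem subsingleton_tor_iff (res : LinearResolution R X) (M : Type) [AddCommGroup M] [Module R M]
    (k : ℕ) : Subsingleton (torMod R (k + 1) M X) ↔
      Function.Exact ((res.d (k + 1)).lTensor M) ((res.d k).lTensor M) := by
  have e := res.toProjectiveResolution.isoLeftDerivedObj
    ((MonoidalCategory.tensoringLeft _).obj (ModuleCat.of R M)) (k + 1)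
  have e' := e.toLinearEquiv.toEquiv.subsingleton_congr
  refine Iff.trans e' ?_
  erw [← ModuleCat.isZero_iff_subsingleton,
    ← HomologicalComplex.exactAt_iff_isZero_homology,
    HomologicalComplex.exactAt_iff' _ (k + 2) (k + 1) k (by simp) (by simp),
    ShortComplex.ShortExact.moduleCat_exact_iff_function_exact]
  change Function.Exact (MonoidalCategory.whiskerLeft (ModuleCat.of R M)
    (res.complex.d (k + 2) (k + 1))) (MonoidalCategory.whiskerLeft (ModuleCat.of R M)
    (res.complex.d (k + 1) k)) ↔ _
  rw [res.complex_d, res.complex_d]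
  rfl

/-- Prolong a resolution of `K` to a resolution of `X` along an exact sequence
`0 → K → P → X → 0` with `P` projective. -/
def splice {K P : Type} [AddCommGroup K] [Module R K] [AddCommGroup P] [Module R P]
    [Module.Projective R P] (res : LinearResolution R K) {i : K →ₗ[R] P} {p : P →ₗ[R] X}
    (hi : Function.Injective i) (hip : Function.Exact i p) (hp : Function.Surjective p) :
    LinearResolution R X where
  F | 0 => ModuleCat.of R P
    | n + 1 => res.F n
  projective
    | 0 => inferInstanceAs (Module.Projective R P)
    | n + 1 => res.projective n
  d | 0 => i ∘ₗ res.ε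
    | n + 1 => res.d n
  ε := p
  surj := hp
  exact_at_zero := fun y => (hip y).trans
    ⟨fun ⟨z, hz⟩ => (res.surj z).imp fun _ hw => (congrArg i hw).trans hz, fun ⟨_, hw⟩ => ⟨_, hw⟩⟩
  exact_at
    | 0 => fun y => ((map_eq_zero_iff i hi).trans (res.exact_at_zero y))
    | n + 1 => res.exact_at n

/-- The resolution of the first syzygy obtained by truncating a resolution. -/
def tail (res : LinearResolution R X) : LinearResolution R (LinearMap.ker res.ε) where
  F n := res.F (n + 1)
  projective n := res.projective (n + 1)
  d n := res.d (n + 1)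
  ε := (res.d 0).codRestrict _ fun x => res.exact_at_zero.apply_apply_eq_zero x
  surj y := ((res.exact_at_zero y).1 y.2).imp fun _ h => Subtype.ext h
  exact_at_zero y := Subtype.ext_iff.trans (res.exact_at 0 y)
  exact_at n := res.exact_at (n + 1)

end LinearResolution

section DimensionShift

variable {R : Type} [CommRing R] {K P X : Type} [AddCommGroup K] [Module R K]
  [AddCommGroup P] [Module R P] [AddCommGroup X] [Module R X] [Module.Projective R P]
  {i : K →ₗ[R] P} {p : P →ₗ[R] X}

theorem subsingleton_ext_one_of_extends (hi : Function.Injective i) (hip : Function.Exact i p)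
    (hp : Function.Surjective p) (N : Type) [AddCommGroup N] [Module R N]
    (h : ∀ g : K →ₗ[R] N, ∃ g' : P →ₗ[R] N, g' ∘ₗ i = g) : Subsingleton (extMod R 1 X N) := by
  obtain ⟨res⟩ := LinearResolution.nonempty (R := R) (X := K)
  rw [(res.splice hi hip hp).subsingleton_ext_iff N 0]
  refine fun g => ⟨fun hg => ?_, ?_⟩
  · change res.F 0 →ₗ[R] N at g
    change g ∘ₗ res.d 0 = 0 at hg
    have hker : LinearMap.ker res.ε ≤ LinearMap.ker g := fun x hx => by
      obtain ⟨y, rfl⟩ := (res.exact_at_zero x).1 hx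
      exact LinearMap.congr_fun hg y
    let g₀ : K →ₗ[R] N := (LinearMap.ker res.ε).liftQ g hker ∘ₗ
      (res.ε.quotKerEquivOfSurjective res.surj).symm.toLinearMap
    have hg₀ (x : res.F 0) : g₀ (res.ε x) = g x := by
      have : (res.ε.quotKerEquivOfSurjective res.surj).symm (res.ε x) =
          Submodule.Quotient.mk x := by
        rw [LinearEquiv.symm_apply_eq]; rfl
      simp [g₀, this]
    obtain ⟨g', hg'⟩ := h g₀
    refine ⟨g', LinearMap.ext fun x => ?_⟩
    exact (LinearMap.congr_fun hg' (res.ε x)).trans (hg₀ x)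
  · rintro ⟨g', rfl⟩
    exact LinearMap.ext fun x => (congrArg g'
      ((res.splice hi hip hp).exact_at 0 |>.apply_apply_eq_zero x)).trans (map_zero _)

theorem subsingleton_ext_succ_of_subsingleton_ext (hi : Function.Injective i)
    (hip : Function.Exact i p) (hp : Function.Surjective p) (N : Type) [AddCommGroup N]
    [Module R N] {k : ℕ} (h : Subsingleton (extMod R (k + 1) K N)) :
    Subsingleton (extMod R (k + 2) X N) := by
  obtain ⟨res⟩ := LinearResolution.nonempty (R := R) (X := K)
  rw [(res.splice hi hip hp).subsingleton_ext_iff N (k + 1)]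
  exact (res.subsingleton_ext_iff N k).1 h

end DimensionShift

namespace LinearResolution

variable {R : Type} [CommRing R] {X : Type} [AddCommGroup X] [Module R X]

theorem lTensor_ker_subtype_injective {Y : Type} [AddCommGroup Y] [Module R Y]
    (G : LinearResolution R Y)
    (hG : Function.Exact ((G.d 1).lTensor X) ((G.d 0).lTensor X)) :
    Function.Injective ((LinearMap.ker G.ε).subtype.lTensor X) := by
  rw [injective_iff_map_eq_zero]
  intro z hz
  obtain ⟨x, rfl⟩ := LinearMap.lTensor_surjective X G.tail.surj z
  rw [← LinearMap.lTensor_comp_apply] at hz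
  obtain ⟨w, rfl⟩ := (hG x).1 hz
  exact (lTensor_exact X G.tail.exact_at_zero G.tail.surj).apply_apply_eq_zero w

/-- The diagram chase relating the homology of `F ⊗ Y` to that of `F ⊗ K`, where `K` is the first
syzygy of `Y`. -/
theorem rTensor_exact_of_ker (F : LinearResolution R X) {Y : Type} [AddCommGroup Y] [Module R Y]
    (G : LinearResolution R Y) (n : ℕ)
    (H : ∀ (y : F.F n ⊗[R] LinearMap.ker G.ε) (x : F.F (n + 1) ⊗[R] G.F 0),
      (F.d n).rTensor (G.F 0) x = (LinearMap.ker G.ε).subtype.lTensor (F.F n) y →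
      y ∈ Set.range ((F.d n).rTensor (LinearMap.ker G.ε))) :
    Function.Exact ((F.d (n + 1)).rTensor Y) ((F.d n).rTensor Y) := by
  have hKG : Function.Exact (LinearMap.ker G.ε).subtype G.ε :=
    LinearMap.exact_subtype_ker_map G.ε
  refine fun x => ⟨fun hx => ?_, ?_⟩
  · obtain ⟨x', rfl⟩ := LinearMap.lTensor_surjective (F.F (n + 1)) G.surj x
    rw [← LinearMap.comp_apply, LinearMap.rTensor_comp_lTensor, ← LinearMap.lTensor_comp_rTensor,
      LinearMap.comp_apply] at hx
    obtain ⟨y, hy⟩ := (lTensor_exact (F.F n) hKG G.surj _).1 hx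
    obtain ⟨y', rfl⟩ := H y x' hy.symm
    rw [← LinearMap.comp_apply, LinearMap.lTensor_comp_rTensor, ← LinearMap.rTensor_comp_lTensor,
      LinearMap.comp_apply] at hy
    obtain ⟨w, hw⟩ := (Module.Flat.rTensor_exact (G.F 0) (F.exact_at n)
      (x' - (LinearMap.ker G.ε).subtype.lTensor (F.F (n + 1)) y')).1 (by
        rw [map_sub, hy, sub_self])
    refine ⟨G.ε.lTensor _ w, ?_⟩
    rw [← LinearMap.comp_apply, LinearMap.rTensor_comp_lTensor, ← LinearMap.lTensor_comp_rTensor,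
      LinearMap.comp_apply, hw, map_sub,
      (lTensor_exact (F.F (n + 1)) hKG G.surj).apply_apply_eq_zero, sub_zero]
  · rintro ⟨w, rfl⟩
    rw [← LinearMap.rTensor_comp_apply, (F.exact_at n).linearMap_comp_eq_zero,
      LinearMap.rTensor_zero, LinearMap.zero_apply]

/-- If `X` and `Y` are resolved by `F` and `G`, then `F ⊗ Y` is acyclic in positive degrees as soon
as `X ⊗ G` is. -/
theorem rTensor_exact_of_lTensor_exact (F : LinearResolution R X) (k : ℕ) :
    ∀ {Y : Type} [AddCommGroup Y] [Module R Y] (G : LinearResolution R Y),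
      (∀ n, Function.Exact ((G.d (n + 1)).lTensor X) ((G.d n).lTensor X)) →
      Function.Exact ((F.d (k + 1)).rTensor Y) ((F.d k).rTensor Y) := by
  induction k with
  | zero =>
    intro Y _ _ G hG
    refine F.rTensor_exact_of_ker G 0 fun y x hyx => ?_
    refine (rTensor_exact _ F.exact_at_zero F.surj y).1 ?_
    refine (map_eq_zero_iff _ (G.lTensor_ker_subtype_injective (hG 0))).1 ?_
    rw [← LinearMap.comp_apply, LinearMap.lTensor_comp_rTensor, ← LinearMap.rTensor_comp_lTensor,
      LinearMap.comp_apply, ← hyx]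
    exact (rTensor_exact _ F.exact_at_zero F.surj).apply_apply_eq_zero x
  | succ k ih =>
    intro Y _ _ G hG
    refine F.rTensor_exact_of_ker G (k + 1) fun y x hyx => ?_
    refine (ih G.tail (fun n => hG (n + 1)) y).1 ?_
    refine (map_eq_zero_iff _ (Module.Flat.lTensor_preserves_injective_linearMap (M := F.F k) _
      (LinearMap.ker G.ε).injective_subtype)).1 ?_
    rw [← LinearMap.comp_apply, LinearMap.lTensor_comp_rTensor, ← LinearMap.rTensor_comp_lTensor,
      LinearMap.comp_apply, ← hyx, ← LinearMap.rTensor_comp_apply,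
      (F.exact_at k).linearMap_comp_eq_zero, LinearMap.rTensor_zero, LinearMap.zero_apply]

end LinearResolution

/-- The canonical map `F ⊗ N → Hom(F^*, N)`. -/
noncomputable def tensorToDualHom (R F N : Type) [CommRing R] [AddCommGroup F] [Module R F]
    [AddCommGroup N] [Module R N] : F ⊗[R] N →ₗ[R] Module.Dual R F →ₗ[R] N :=
  dualTensorHom R (Module.Dual R F) N ∘ₗ (Module.Dual.eval R F).rTensor N

section TensorToDualHom

variable {R F F' N : Type} [CommRing R] [AddCommGroup F] [Module R F] [AddCommGroup F']
  [Module R F'] [AddCommGroup N] [Module R N]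

theorem tensorToDualHom_bijective [Module.Free R F] [Module.Finite R F] :
    Function.Bijective (tensorToDualHom R F N) :=
  ((Module.evalEquiv R F).rTensor N ≪≫ₗ dualTensorHomEquiv R (Module.Dual R F) N).bijective

theorem tensorToDualHom_rTensor (f : F →ₗ[R] F') (x : F ⊗[R] N) :
    tensorToDualHom R F' N (f.rTensor N x) = tensorToDualHom R F N x ∘ₗ f.dualMap := by
  induction x with
  | zero => simp
  | add x y hx hy => simp [hx, hy, LinearMap.add_comp]
  | tmul a b => ext; simp [tensorToDualHom]

end TensorToDualHom

namespace FiniteFreeResolution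

variable {R : Type} [CommRing R] {M : Type} [AddCommGroup M] [Module R M]

/-- A finite free resolution, viewed as a resolution by projectives. -/
def toLinearResolution (res : FiniteFreeResolution R M) : LinearResolution R M where
  F n := ModuleCat.of R (res.F n)
  projective n := have := res.free n; inferInstanceAs (Module.Projective R (res.F n))
  d := res.d
  ε := res.ε
  surj := res.surj
  exact_at_zero := res.exact_at_zero
  exact_at := res.exact_at

theorem dualMap_exact_of_subsingleton_ext (res : FiniteFreeResolution R M) (n : ℕ)
    (h : Subsingleton (extMod R (n + 1) M R)) :
    Function.Exact (res.d n).dualMap (res.d (n + 1)).dualMap :=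
  (res.toLinearResolution.subsingleton_ext_iff R n).1 h

theorem rTensor_exact_of_subsingleton_tor (res : FiniteFreeResolution R M) {N : Type}
    [AddCommGroup N] [Module R N] (h : ∀ i : ℕ, 1 ≤ i → Subsingleton (torMod R i M N)) (n : ℕ) :
    Function.Exact ((res.d (n + 1)).rTensor N) ((res.d n).rTensor N) := by
  obtain ⟨G⟩ := LinearResolution.nonempty (R := R) (X := N)
  exact res.toLinearResolution.rTensor_exact_of_lTensor_exact n G fun k =>
    (G.subsingleton_tor_iff M k).1 (h (k + 1) k.succ_pos)

/-- The map `Tr Ω^n M → F_{n+2}^*` induced by the dual of the differential. -/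
noncomputable def trSyzygyToDual (res : FiniteFreeResolution R M) (n : ℕ) :
    res.trSyzygy n →ₗ[R] Module.Dual R (res.F (n + 2)) :=
  (LinearMap.range (res.d n).dualMap).liftQ (res.d (n + 1)).dualMap (by
    rintro _ ⟨f, rfl⟩
    exact LinearMap.ext fun x => (congrArg f ((res.exact_at n).apply_apply_eq_zero x)).trans
      (map_zero f))

theorem trSyzygyToDual_injective (res : FiniteFreeResolution R M) (n : ℕ)
    (h : Subsingleton (extMod R (n + 1) M R)) : Function.Injective (res.trSyzygyToDual n) := by
  rw [← LinearMap.ker_eq_bot]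
  exact Submodule.ker_liftQ_eq_bot _ _ _
    (res.dualMap_exact_of_subsingleton_ext n h).linearMap_ker_eq.le

theorem trSyzygyToDual_exact (res : FiniteFreeResolution R M) (n : ℕ) :
    Function.Exact (res.trSyzygyToDual n) (LinearMap.range (res.d (n + 1)).dualMap).mkQ := by
  rw [LinearMap.exact_iff, Submodule.ker_mkQ, trSyzygyToDual, Submodule.range_liftQ]

theorem exists_extension_trSyzygyToDual (res : FiniteFreeResolution R M) {N : Type}
    [AddCommGroup N] [Module R N] (n : ℕ)
    (h : Function.Exact ((res.d (n + 1)).rTensor N) ((res.d n).rTensor N))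
    (g : res.trSyzygy n →ₗ[R] N) :
    ∃ g' : Module.Dual R (res.F (n + 2)) →ₗ[R] N, g' ∘ₗ res.trSyzygyToDual n = g := by
  have := res.free
  have := res.finite
  obtain ⟨x, hx⟩ := (tensorToDualHom_bijective (R := R) (F := res.F (n + 1)) (N := N)).2
    (g ∘ₗ (LinearMap.range (res.d n).dualMap).mkQ)
  have hx0 : (res.d n).rTensor N x = 0 := by
    apply (tensorToDualHom_bijective (R := R) (F := res.F n) (N := N)).1
    rw [tensorToDualHom_rTensor, hx, map_zero, LinearMap.comp_assoc, LinearMap.range_mkQ_comp,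
      LinearMap.comp_zero]
  obtain ⟨y, rfl⟩ := (h x).1 hx0
  refine ⟨tensorToDualHom R _ N y, Submodule.linearMap_qext _ ?_⟩
  rw [← hx, tensorToDualHom_rTensor, LinearMap.comp_assoc, trSyzygyToDual, Submodule.liftQ_mkQ]

end FiniteFreeResolution

/-- If `Ext^i_R(M, R) = 0` and `Tor_i^R(M, N) = 0` for all `i ≥ 1`, then for every
`t ≥ 2` and every `j` with `1 ≤ j ≤ t - 1` one has `Ext^j_R(Tr Ω^{t-1} M, N) = 0`. -/
theorem ext_trSyzygy_vanishing_of_ext_tor_vanishing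
    (R : Type) [CommRing R] [IsNoetherianRing R] [IsLocalRing R]
    (M N : Type) [AddCommGroup M] [Module R M] [AddCommGroup N] [Module R N]
    [Module.Finite R M] [Module.Finite R N]
    (res : FiniteFreeResolution R M)
    (hext : ∀ i : ℕ, 1 ≤ i → Subsingleton (extMod R i M R))
    (htor : ∀ i : ℕ, 1 ≤ i → Subsingleton (torMod R i M N)) :
    ∀ t j : ℕ, 2 ≤ t → 1 ≤ j → j ≤ t - 1 →
      Subsingleton (extMod R j (res.trSyzygy (t - 1)) N) := by
  have key (k : ℕ) : ∀ n, k ≤ n → Subsingleton (extMod R (k + 1) (res.trSyzygy (n + 1)) N) := by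
    have := res.free
    have := res.finite
    induction k with
    | zero =>
      exact fun n _ => subsingleton_ext_one_of_extends
        (res.trSyzygyToDual_injective n (hext _ n.succ_pos)) (res.trSyzygyToDual_exact n)
        (Submodule.mkQ_surjective _) N
        (res.exists_extension_trSyzygyToDual n (res.rTensor_exact_of_subsingleton_tor htor n))
    | succ k ih =>
      intro n hn
      obtain ⟨n, rfl⟩ : ∃ m, n = m + 1 := ⟨n - 1, by omega⟩
      exact subsingleton_ext_succ_of_subsingleton_ext
        (res.trSyzygyToDual_injective (n + 1) (hext _ (n + 1).succ_pos))
        (res.trSyzygyToDual_exact (n + 1)) (Submodule.mkQ_surjective _) N (ih n (by omega))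
  intro t j ht hj hjt
  obtain ⟨n, rfl⟩ : ∃ n, t = n + 2 := ⟨t - 2, by omega⟩
  obtain ⟨k, rfl⟩ : ∃ k, j = k + 1 := ⟨j - 1, by omega⟩
  exact key k n (by omega)
end
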